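/- arXiv:1010.3673 — 3 statements merged into one kernel-verified Lean document; each statement's English description precedes it below -/
import Mathlib

section
/- Let F be a tree-graded space with respect to pieces P, and let {T_i : i ∈ I} be the collection of all transversal trees of F. Then F is tree-graded with respect to the collection P ∪ {T_i : i ∈ I}: every two distinct sets in this collection intersect in at most one point, and every nontrivial simple geodesic triangle is contained in one of them. -/
/-- A map `γ` is a geodesic (unit-speed) on the interval `[a,b]`. -/
def IsGeodesicOn {F : Type*} [MetricSpace F] (γ : ℝ → F) (a b : ℝ) : Prop :=
  ∀ s ∈ Set.Icc a b, ∀ t ∈ Set.Icc a b, dist (γ s) (γ t) = |s - t|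

/-- A metric space is geodesic if every two points are joined by a geodesic. -/
def GeodesicSpace (F : Type*) [MetricSpace F] : Prop :=
  ∀ x y : F, ∃ γ : ℝ → F, γ 0 = x ∧ γ (dist x y) = y ∧ IsGeodesicOn γ 0 (dist x y)

/-- A subset is geodesic: any two of its points are joined by a geodesic inside it. -/
def GeodesicSubset {F : Type*} [MetricSpace F] (p : Set F) : Prop :=
  ∀ x ∈ p, ∀ y ∈ p, ∃ γ : ℝ → F, γ 0 = x ∧ γ (dist x y) = y ∧
    IsGeodesicOn γ 0 (dist x y) ∧ γ '' Set.Icc 0 (dist x y) ⊆ p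

/-- A nontrivial simple geodesic triangle: a simple loop `γ` on `[0,L]` composed of three
geodesics `[0,a]`, `[a,b]`, `[b,L]`. -/
structure SimpleGeodesicTriangle {F : Type*} [MetricSpace F]
    (γ : ℝ → F) (a b L : ℝ) : Prop where
  L_pos : 0 < L
  ha : 0 ≤ a
  hab : a ≤ b
  hbL : b ≤ L
  side1 : IsGeodesicOn γ 0 a
  side2 : IsGeodesicOn γ a b
  side3 : IsGeodesicOn γ b L
  closed : γ 0 = γ L
  simple : Set.InjOn γ (Set.Ico 0 L)

/-- `F` is tree-graded with respect to the collection `P` of pieces. -/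
structure IsTreeGraded {F : Type*} [MetricSpace F] (P : Set (Set F)) : Prop where
  pieces_nonempty : ∀ p ∈ P, p.Nonempty
  pieces_closed : ∀ p ∈ P, IsClosed p
  pieces_geodesic : ∀ p ∈ P, GeodesicSubset p
  T1 : ∀ p ∈ P, ∀ q ∈ P, p ≠ q → (p ∩ q).Subsingleton
  T2 : ∀ (γ : ℝ → F) (a b L : ℝ), SimpleGeodesicTriangle γ a b L →
    ∃ p ∈ P, γ '' Set.Icc 0 L ⊆ p

/-- The transversal tree of `F` at `x`: the set of points `y` such that every geodesic
from `x` to `y` intersects every piece in at most one point. -/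
def transversalTree {F : Type*} [MetricSpace F] (P : Set (Set F)) (x : F) : Set F :=
  {y | ∀ γ : ℝ → F, γ 0 = x → γ (dist x y) = y → IsGeodesicOn γ 0 (dist x y) →
    ∀ p ∈ P, (γ '' Set.Icc 0 (dist x y) ∩ p).Subsingleton}

namespace TreeGraded

open Set

variable {F : Type*} [MetricSpace F]

/-- `S` is the image of a geodesic from `x` to `y`. -/
def IsSegment (x y : F) (S : Set F) : Prop :=
  ∃ γ : ℝ → F, γ 0 = x ∧ γ (dist x y) = y ∧ IsGeodesicOn γ 0 (dist x y) ∧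
    γ '' Icc 0 (dist x y) = S

theorem isSegment_image {γ : ℝ → F} {a b : ℝ} (hab : a ≤ b) (hγ : IsGeodesicOn γ a b) :
    IsSegment (γ a) (γ b) (γ '' Icc a b) := by
  have hd : dist (γ a) (γ b) = b - a := by
    rw [hγ a ⟨le_rfl, hab⟩ b ⟨hab, le_rfl⟩, abs_sub_comm, abs_of_nonneg (by linarith)]
  refine ⟨fun t => γ (a + t), by simp, by simp [hd], ?_, ?_⟩
  · rw [hd]
    intro s hs t ht
    rw [hγ (a + s) ⟨by linarith [hs.1], by linarith [hs.2]⟩ (a + t)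
      ⟨by linarith [ht.1], by linarith [ht.2]⟩]
    congr 1
    ring
  · rw [hd]
    ext w
    constructor
    · rintro ⟨t, ht, rfl⟩
      exact ⟨a + t, ⟨by linarith [ht.1], by linarith [ht.2]⟩, rfl⟩
    · rintro ⟨t, ht, rfl⟩
      exact ⟨t - a, ⟨by linarith [ht.1], by linarith [ht.2]⟩, by simp⟩

namespace IsSegment

variable {x y u v w : F} {S T : Set F}

theorem symm (h : IsSegment x y S) : IsSegment y x S := by
  obtain ⟨γ, h0, h1, hγ, rfl⟩ := h
  refine ⟨fun t => γ (dist x y - t), ?_, ?_, ?_, ?_⟩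
  · simpa using h1
  · simpa [dist_comm y x] using h0
  · rw [dist_comm y x]
    intro s hs t ht
    rw [hγ (dist x y - s) ⟨by linarith [hs.2], by linarith [hs.1]⟩ (dist x y - t)
      ⟨by linarith [ht.2], by linarith [ht.1]⟩, abs_sub_comm]
    congr 1
    ring
  · rw [dist_comm y x]
    ext w
    constructor
    · rintro ⟨t, ht, rfl⟩
      exact ⟨dist x y - t, ⟨by linarith [ht.2], by linarith [ht.1]⟩, rfl⟩
    · rintro ⟨t, ht, rfl⟩
      exact ⟨dist x y - t, ⟨by linarith [ht.2], by linarith [ht.1]⟩, by simp⟩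

theorem left_mem (h : IsSegment x y S) : x ∈ S := by
  obtain ⟨γ, h0, h1, hγ, rfl⟩ := h
  exact ⟨0, ⟨le_rfl, dist_nonneg⟩, h0⟩

theorem right_mem (h : IsSegment x y S) : y ∈ S := h.symm.left_mem

theorem isCompact (h : IsSegment x y S) : IsCompact S := by
  obtain ⟨γ, h0, h1, hγ, rfl⟩ := h
  refine isCompact_Icc.image_of_continuousOn (LipschitzOnWith.continuousOn (K := 1) ?_)
  exact LipschitzOnWith.of_dist_le_mul fun s hs t ht => by
    simp [hγ s hs t ht, Real.dist_eq]

theorem dist_add (h : IsSegment x y S) (hu : u ∈ S) : dist x u + dist u y = dist x y := by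
  obtain ⟨γ, h0, h1, hγ, rfl⟩ := h
  obtain ⟨t, ht, rfl⟩ := hu
  have e0 := hγ 0 ⟨le_rfl, dist_nonneg⟩ t ht
  have e1 := hγ t ht (dist x y) ⟨dist_nonneg, le_rfl⟩
  rw [h0, abs_sub_comm, abs_of_nonneg (by linarith [ht.1])] at e0
  rw [h1, abs_sub_comm, abs_of_nonneg (by linarith [ht.2])] at e1
  linarith

theorem dist_eq (h : IsSegment x y S) (hu : u ∈ S) (hv : v ∈ S) :
    dist u v = |dist x u - dist x v| := by
  obtain ⟨γ, h0, h1, hγ, rfl⟩ := h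
  obtain ⟨s, hs, rfl⟩ := hu
  obtain ⟨t, ht, rfl⟩ := hv
  have e (r) (hr : r ∈ Icc 0 (dist x y)) : dist x (γ r) = r := by
    have := hγ 0 ⟨le_rfl, dist_nonneg⟩ r hr
    rwa [h0, abs_sub_comm, abs_of_nonneg (by linarith [hr.1]), sub_zero] at this
  rw [e s hs, e t ht, hγ s hs t ht]

theorem eq_of_dist_eq (h : IsSegment x y S) (hu : u ∈ S) (hv : v ∈ S)
    (huv : dist x u = dist x v) : u = v := by
  have := h.dist_eq hu hv
  rwa [huv, sub_self, abs_zero, dist_eq_zero] at this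

theorem sub (h : IsSegment x y S) (hu : u ∈ S) (hv : v ∈ S) (huv : dist x u ≤ dist x v) :
    IsSegment u v {w | w ∈ S ∧ dist x u ≤ dist x w ∧ dist x w ≤ dist x v} := by
  obtain ⟨γ, h0, h1, hγ, rfl⟩ := h
  obtain ⟨s, hs, rfl⟩ := hu
  obtain ⟨t, ht, rfl⟩ := hv
  have e (r) (hr : r ∈ Icc 0 (dist x y)) : dist x (γ r) = r := by
    have := hγ 0 ⟨le_rfl, dist_nonneg⟩ r hr
    rwa [h0, abs_sub_comm, abs_of_nonneg (by linarith [hr.1]), sub_zero] at this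
  rw [e s hs, e t ht] at *
  have key := isSegment_image huv (γ := γ) fun a ha b hb =>
    hγ a ⟨hs.1.trans ha.1, ha.2.trans ht.2⟩ b ⟨hs.1.trans hb.1, hb.2.trans ht.2⟩
  convert key using 1
  ext w
  constructor
  · rintro ⟨⟨r, hr, rfl⟩, h⟩
    rw [e r hr] at h
    exact ⟨r, h, rfl⟩
  · rintro ⟨r, hr, rfl⟩
    have hr' : r ∈ Icc 0 (dist x y) := ⟨hs.1.trans hr.1, hr.2.trans ht.2⟩
    refine ⟨⟨r, hr', rfl⟩, ?_⟩
    rw [e r hr']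
    exact hr

theorem initial_sub (h : IsSegment x y S) (hu : u ∈ S) :
    IsSegment x u {w | w ∈ S ∧ dist x w ≤ dist x u} := by
  simpa using h.sub h.left_mem hu (by simp)

theorem union (hS : IsSegment x u S) (hT : IsSegment u y T)
    (hu : dist x u + dist u y = dist x y) : IsSegment x y (S ∪ T) := by
  obtain ⟨γ, h0, h1, hγ, rfl⟩ := hS
  obtain ⟨δ, k0, k1, hδ, rfl⟩ := hT
  have hxu : 0 ≤ dist x u := dist_nonneg
  have huy : 0 ≤ dist u y := dist_nonneg
  set f : ℝ → F := fun t => if t ≤ dist x u then γ t else δ (t - dist x u) with hf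
  have f1 (t) (ht : t ≤ dist x u) : f t = γ t := if_pos ht
  have f2 (t) (ht : dist x u ≤ t) : f t = δ (t - dist x u) := by
    rcases ht.eq_or_lt with rfl | ht
    · rw [f1 _ le_rfl, h1, sub_self, k0]
    · exact if_neg ht.not_ge
  have f0 : f 0 = x := by rw [f1 _ hxu, h0]
  have f3 : f (dist x y) = y := by rw [f2 _ (by linarith), ← hu, add_sub_cancel_left, k1]
  have cross (s t : ℝ) (hs : s ∈ Icc 0 (dist x u)) (ht : t ∈ Icc (dist x u) (dist x y)) :
      dist (f s) (f t) = t - s := by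
    have ht' : t - dist x u ∈ Icc 0 (dist u y) := ⟨by linarith [ht.1], by linarith [ht.2]⟩
    have e1 := hγ 0 ⟨le_rfl, hxu⟩ s hs
    have e2 := hγ s hs _ ⟨hxu, le_rfl⟩
    have e3 := hδ 0 ⟨le_rfl, huy⟩ _ ht'
    have e4 := hδ _ ht' _ ⟨huy, le_rfl⟩
    rw [abs_sub_comm, abs_of_nonneg (by linarith [hs.1]), ← f1 s hs.2, h0] at e1
    rw [abs_sub_comm, abs_of_nonneg (by linarith [hs.2]), ← f1 s hs.2, h1] at e2
    rw [abs_sub_comm, abs_of_nonneg (by linarith [ht'.1]), ← f2 t ht.1, k0] at e3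
    rw [abs_sub_comm, abs_of_nonneg (by linarith [ht'.2]), ← f2 t ht.1, k1] at e4
    have i1 := dist_triangle (f s) u (f t)
    have i2 := dist_triangle4 x (f s) (f t) y
    apply le_antisymm <;> linarith
  refine ⟨f, f0, f3, ?_, ?_⟩
  · intro s hs t ht
    rcases le_total s (dist x u) with h | h <;> rcases le_total t (dist x u) with h' | h'
    · rw [f1 _ h, f1 _ h', hγ s ⟨hs.1, h⟩ t ⟨ht.1, h'⟩]
    · rw [cross s t ⟨hs.1, h⟩ ⟨h', ht.2⟩, abs_sub_comm, abs_of_nonneg (by linarith)]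
    · rw [dist_comm, cross t s ⟨ht.1, h'⟩ ⟨h, hs.2⟩, abs_of_nonneg (by linarith)]
    · rw [f2 _ h, f2 _ h', hδ _ ⟨by linarith, by linarith [hs.2]⟩ _
        ⟨by linarith, by linarith [ht.2]⟩]
      congr 1
      ring
  · ext w
    constructor
    · rintro ⟨t, ht, rfl⟩
      rcases le_total t (dist x u) with h | h
      · exact .inl ⟨t, ⟨ht.1, h⟩, (f1 t h).symm⟩
      · exact .inr ⟨t - dist x u, ⟨by linarith, by linarith [ht.2]⟩, (f2 t h).symm⟩
    · rintro (⟨t, ht, rfl⟩ | ⟨t, ht, rfl⟩)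
      · exact ⟨t, ⟨ht.1, by linarith [ht.2]⟩, f1 t ht.2⟩
      · exact ⟨t + dist x u, ⟨by linarith [ht.1], by linarith [ht.2]⟩, by
          rw [f2 _ (by linarith [ht.1]), add_sub_cancel_right]⟩

end IsSegment

theorem exists_farthest {K : Set F} (hK : IsCompact K) (hne : K.Nonempty) (x : F) :
    ∃ w ∈ K, ∀ v ∈ K, dist x v ≤ dist x w :=
  hK.exists_isMaxOn hne (f := dist x) (by fun_prop)

theorem exists_nearest {K : Set F} (hK : IsCompact K) (hne : K.Nonempty) (x : F) :
    ∃ w ∈ K, ∀ v ∈ K, dist x w ≤ dist x v :=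
  hK.exists_isMinOn hne (f := dist x) (by fun_prop)

theorem isClosed_le_dist (x : F) (r : ℝ) : IsClosed {w : F | r ≤ dist x w} :=
  isClosed_le (by fun_prop) (by fun_prop)

theorem isClosed_dist_le (x : F) (r : ℝ) : IsClosed {w : F | dist x w ≤ r} :=
  isClosed_le (by fun_prop) (by fun_prop)

theorem mem_transversalTree_iff {P : Set (Set F)} {x y : F} :
    y ∈ transversalTree P x ↔ ∀ S, IsSegment x y S → ∀ p ∈ P, (S ∩ p).Subsingleton := by
  constructor
  · rintro h _ ⟨γ, h0, h1, hγ, rfl⟩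
    exact h γ h0 h1 hγ
  · intro h γ h0 h1 hγ
    exact h _ ⟨γ, h0, h1, hγ, rfl⟩

theorem mem_transversalTree_symm {P : Set (Set F)} {x y : F} (h : y ∈ transversalTree P x) :
    x ∈ transversalTree P y := by
  rw [mem_transversalTree_iff] at h ⊢
  exact fun S hS => h S hS.symm

theorem exists_isSegment (hF : GeodesicSpace F) (x y : F) : ∃ S, IsSegment x y S := by
  obtain ⟨γ, h0, h1, hγ⟩ := hF x y
  exact ⟨_, γ, h0, h1, hγ, rfl⟩

variable {P : Set (Set F)}

/-- The alternative `w = y ∧ y = z` allows bigons, as triangles with a constant side. -/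
theorem exists_piece_of_triangle (hP : IsTreeGraded P) {x y z : F} {S T U : Set F}
    (hS : IsSegment x y S) (hT : IsSegment y z T) (hU : IsSegment z x U) (hxy : x ≠ y)
    (hST : ∀ w ∈ S, w ∈ T → w = y) (hTU : ∀ w ∈ T, w ∈ U → w = z)
    (hUS : ∀ w ∈ U, w ∈ S → w = x ∨ w = y ∧ y = z) :
    ∃ p ∈ P, S ⊆ p ∧ T ⊆ p ∧ U ⊆ p := by
  obtain ⟨α, a0, a1, hα, rfl⟩ := hS
  obtain ⟨β, b0, b1, hβ, rfl⟩ := hT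
  obtain ⟨δ, d0, d1, hδ, rfl⟩ := hU
  have ha : 0 < dist x y := dist_pos.2 hxy
  have hb : 0 ≤ dist y z := dist_nonneg
  have hc : 0 ≤ dist z x := dist_nonneg
  generalize dist x y = a at *
  generalize dist y z = b at *
  generalize dist z x = c at *
  set f : ℝ → F := fun t => if t ≤ a then α t else if t ≤ a + b then β (t - a)
    else δ (t - (a + b)) with hf
  have f1 (t) (ht : t ≤ a) : f t = α t := if_pos ht
  have f2 (t) (ht : a ≤ t) (ht' : t ≤ a + b) : f t = β (t - a) := by
    rcases ht.eq_or_lt with rfl | ht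
    · rw [f1 _ le_rfl, a1, sub_self, b0]
    · simp only [hf]
      rw [if_neg ht.not_ge, if_pos ht']
  have f3 (t) (ht : a + b ≤ t) : f t = δ (t - (a + b)) := by
    rcases ht.eq_or_lt with rfl | ht
    · rw [f2 _ (by linarith) le_rfl, add_sub_cancel_left, b1, sub_self, d0]
    · simp only [hf]
      rw [if_neg (by linarith), if_neg (by linarith)]
  have s1 : IsGeodesicOn f 0 a := fun s hs t ht => by
    rw [f1 _ hs.2, f1 _ ht.2, hα s hs t ht]
  have s2 : IsGeodesicOn f a (a + b) := fun s hs t ht => by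
    rw [f2 _ hs.1 hs.2, f2 _ ht.1 ht.2, hβ _ ⟨by linarith [hs.1], by linarith [hs.2]⟩ _
      ⟨by linarith [ht.1], by linarith [ht.2]⟩]
    congr 1
    ring
  have s3 : IsGeodesicOn f (a + b) (a + b + c) := fun s hs t ht => by
    rw [f3 _ hs.1, f3 _ ht.1, hδ _ ⟨by linarith [hs.1], by linarith [hs.2]⟩ _
      ⟨by linarith [ht.1], by linarith [ht.2]⟩]
    congr 1
    ring
  have inj {r r' s t : ℝ} (h : IsGeodesicOn f r r') (hs : s ∈ Icc r r') (ht : t ∈ Icc r r')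
      (e : f s = f t) : s = t := by
    have := h s hs t ht
    rw [e, dist_self] at this
    exact sub_eq_zero.1 (abs_eq_zero.1 this.symm)
  have ea : f a = y := by rw [f1 _ le_rfl, a1]
  have eb : f (a + b) = z := by rw [f3 _ le_rfl, sub_self, d0]
  have ec : f (a + b + c) = x := by rw [f3 _ (by linarith), add_sub_cancel_left, d1]
  have m1 (t) (h : t ∈ Icc 0 a) : f t ∈ α '' Icc 0 a := ⟨t, h, (f1 t h.2).symm⟩
  have m2 (t) (h : t ∈ Icc a (a + b)) : f t ∈ β '' Icc 0 b :=
    ⟨t - a, ⟨by linarith [h.1], by linarith [h.2]⟩, (f2 t h.1 h.2).symm⟩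
  have m3 (t) (h : t ∈ Icc (a + b) (a + b + c)) : f t ∈ δ '' Icc 0 c :=
    ⟨t - (a + b), ⟨by linarith [h.1], by linarith [h.2]⟩, (f3 t h.1).symm⟩
  have lt_inj (s t : ℝ) (hs : 0 ≤ s) (hst : s < t) (ht : t < a + b + c) : f s ≠ f t := by
    intro e
    rcases le_or_gt t a with h1 | h1
    · exact hst.ne (inj s1 ⟨hs, by linarith⟩ ⟨by linarith, h1⟩ e)
    rcases le_or_gt t (a + b) with h2 | h2
    · rcases le_or_gt s a with k1 | k1
      · have hy := hST _ (e ▸ m1 s ⟨hs, k1⟩) (m2 t ⟨h1.le, h2⟩)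
        exact h1.ne (inj s2 ⟨le_rfl, by linarith⟩ ⟨h1.le, h2⟩ (ea.trans hy.symm))
      · exact hst.ne (inj s2 ⟨k1.le, by linarith⟩ ⟨h1.le, h2⟩ e)
    have ht3 : t ∈ Icc (a + b) (a + b + c) := ⟨h2.le, ht.le⟩
    have hz : f t ≠ z := fun h =>
      h2.ne (inj s3 ⟨le_rfl, by linarith⟩ ht3 (eb.trans h.symm))
    rcases le_or_gt s a with k1 | k1
    · rcases hUS _ (m3 t ht3) (e ▸ m1 s ⟨hs, k1⟩) with h | ⟨h, h'⟩
      · exact ht.ne (inj s3 ht3 ⟨by linarith, le_rfl⟩ (h.trans ec.symm))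
      · exact hz (h.trans h')
    rcases le_or_gt s (a + b) with k2 | k2
    · exact hz (hTU _ (e ▸ m2 s ⟨k1.le, k2⟩) (m3 t ht3))
    · exact hst.ne (inj s3 ⟨k2.le, by linarith⟩ ht3 e)
  obtain ⟨p, hp, hsub⟩ := hP.T2 f a (a + b) (a + b + c)
    { L_pos := by linarith
      ha := ha.le
      hab := by linarith
      hbL := by linarith
      side1 := s1
      side2 := s2
      side3 := s3
      closed := by rw [ec, f1 _ ha.le, a0]
      simple := fun s hs t ht e => by
        rcases lt_trichotomy s t with h | h | h
        · exact (lt_inj s t hs.1 h ht.2 e).elim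
        · exact h
        · exact (lt_inj t s ht.1 h hs.2 e.symm).elim }
  refine ⟨p, hp, ?_, ?_, ?_⟩
  · rintro _ ⟨t, ht, rfl⟩
    exact hsub ⟨t, ⟨ht.1, by linarith [ht.2]⟩, f1 t ht.2⟩
  · rintro _ ⟨t, ht, rfl⟩
    refine hsub ⟨t + a, ⟨by linarith [ht.1], by linarith [ht.2]⟩, ?_⟩
    rw [f2 _ (by linarith [ht.1]) (by linarith [ht.2]), add_sub_cancel_right]
  · rintro _ ⟨t, ht, rfl⟩
    refine hsub ⟨t + (a + b), ⟨by linarith [ht.1], by linarith [ht.2]⟩, ?_⟩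
    rw [f3 _ (by linarith [ht.1]), add_sub_cancel_right]

theorem exists_isSegment_subset (hP : IsTreeGraded P) {p : Set F} (hp : p ∈ P) {x y : F}
    (hx : x ∈ p) (hy : y ∈ p) : ∃ S, IsSegment x y S ∧ S ⊆ p := by
  obtain ⟨γ, h0, h1, hγ, hsub⟩ := hP.pieces_geodesic p hp x hx y hy
  exact ⟨_, ⟨γ, h0, h1, hγ, rfl⟩, hsub⟩

theorem piece_eq (hP : IsTreeGraded P) {p q : Set F} (hp : p ∈ P) (hq : q ∈ P) {x y : F}
    (hxy : x ≠ y) (hxp : x ∈ p) (hyp : y ∈ p) (hxq : x ∈ q) (hyq : y ∈ q) : q = p := by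
  by_contra h
  exact hxy (hP.T1 q hq p hp h ⟨hxq, hxp⟩ ⟨hyq, hyp⟩)

/-- Pieces are strongly geodesically convex. -/
theorem isSegment_subset_piece (hP : IsTreeGraded P) {p : Set F} (hp : p ∈ P) {x y : F}
    (hx : x ∈ p) (hy : y ∈ p) {S : Set F} (hS : IsSegment x y S) : S ⊆ p := by
  intro t ht
  by_contra htp
  have hpc := hP.pieces_closed p hp
  obtain ⟨u, ⟨⟨huS, hup⟩, hut⟩, humax⟩ := exists_farthest
    ((hS.isCompact.inter_right hpc).inter_right (isClosed_dist_le x (dist x t)))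
    ⟨x, ⟨hS.left_mem, hx⟩, by simp⟩ x
  obtain ⟨v, ⟨⟨hvS, hvp⟩, hvt⟩, hvmin⟩ := exists_nearest
    ((hS.isCompact.inter_right hpc).inter_right (isClosed_le_dist x (dist x t)))
    ⟨y, ⟨hS.right_mem, hy⟩, by
      have := hS.dist_add ht
      have := dist_nonneg (x := t) (y := y)
      simp only [mem_ofPred_eq]
      linarith⟩ x
  simp only [mem_ofPred_eq] at hut hvt
  have hne : u ≠ v := by
    rintro rfl
    exact htp (hS.eq_of_dist_eq huS ht (le_antisymm hut hvt) ▸ hup)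
  obtain ⟨H, hH, hHp⟩ := exists_isSegment_subset hP hp hup hvp
  obtain ⟨T, hT, hTv⟩ := exists_isSegment_subset hP hp hvp hvp
  have hTv' : ∀ w ∈ T, w = v := fun w hw => by
    have h := hT.dist_add hw
    have := dist_nonneg (x := v) (y := w)
    have := dist_nonneg (x := w) (y := v)
    rw [dist_self] at h
    exact dist_le_zero.1 (by linarith)
  obtain ⟨q, hq, hq1, -, hq3⟩ := exists_piece_of_triangle hP (hS.sub huS hvS (hut.trans hvt))
    hT hH.symm hne (fun w _ hw => hTv' w hw) (fun w hw _ => hTv' w hw) (by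
      rintro w hwH ⟨hwS, h1, h2⟩
      rcases le_total (dist x w) (dist x t) with h | h
      · exact .inl (hS.eq_of_dist_eq hwS huS (le_antisymm (humax w ⟨⟨hwS, hHp hwH⟩, h⟩) h1))
      · exact .inr ⟨hS.eq_of_dist_eq hwS hvS (le_antisymm h2 (hvmin w ⟨⟨hwS, hHp hwH⟩, h⟩)), rfl⟩)
  have hqp := piece_eq hP hp hq hne hup hvp (hq3 hH.left_mem) (hq3 hH.right_mem)
  exact htp (hqp ▸ hq1 ⟨ht, hut, hvt⟩)

theorem piece_inter_transversalTree (hF : GeodesicSpace F) (hP : IsTreeGraded P) {p : Set F}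
    (hp : p ∈ P) (x : F) : (p ∩ transversalTree P x).Subsingleton := by
  rintro y ⟨hyp, hy⟩ z ⟨hzp, hz⟩
  by_contra hyz
  obtain ⟨S, hS⟩ := exists_isSegment hF x y
  obtain ⟨T, hT⟩ := exists_isSegment hF x z
  have hSp := mem_transversalTree_iff.1 hy S hS p hp
  have hTp := mem_transversalTree_iff.1 hz T hT p hp
  obtain ⟨H, hH, hHp⟩ := exists_isSegment_subset hP hp hyp hzp
  obtain ⟨w, ⟨hwS, hwT⟩, hw⟩ := exists_farthest (hS.isCompact.inter hT.isCompact)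
    ⟨x, hS.left_mem, hT.left_mem⟩ x
  have hwp : w ∉ p := fun h =>
    hyz ((hSp ⟨hS.right_mem, hyp⟩ ⟨hwS, h⟩).trans (hTp ⟨hwT, h⟩ ⟨hT.right_mem, hzp⟩))
  have le_end {y : F} {S : Set F} (hS : IsSegment x y S) (hwS : w ∈ S) :
      dist x w ≤ dist x y := by
    have := hS.dist_add hwS
    have := dist_nonneg (x := w) (y := y)
    linarith
  obtain ⟨q, hq, hq1, hq2, -⟩ := exists_piece_of_triangle hP
    (hS.sub hwS hS.right_mem (le_end hS hwS)) hH
    (hT.sub hwT hT.right_mem (le_end hT hwT)).symm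
    (fun h => hwp (h ▸ hyp))
    (fun v hv hvH => hSp ⟨hv.1, hHp hvH⟩ ⟨hS.right_mem, hyp⟩)
    (fun v hvH hv => hTp ⟨hv.1, hHp hvH⟩ ⟨hT.right_mem, hzp⟩)
    (fun v hvT hvS => .inl (hS.eq_of_dist_eq hvS.1 hwS
      (le_antisymm (hw v ⟨hvS.1, hvT.1⟩) hvS.2.1)))
  have hqp := piece_eq hP hp hq hyz hyp hzp (hq2 hH.left_mem) (hq2 hH.right_mem)
  exact hwp (hqp ▸ hq1 ⟨hwS, le_rfl, le_end hS hwS⟩)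

theorem mem_transversalTree_trans (hF : GeodesicSpace F) (hP : IsTreeGraded P) {x y z : F}
    (hy : y ∈ transversalTree P x) (hz : z ∈ transversalTree P y) :
    z ∈ transversalTree P x := by
  rw [mem_transversalTree_iff] at hy hz ⊢
  intro S hS p hp
  obtain ⟨S₁, hS₁⟩ := exists_isSegment hF x y
  obtain ⟨S₂, hS₂⟩ := exists_isSegment hF y z
  obtain ⟨w, ⟨hwS, hwS₁⟩, hw⟩ := exists_farthest (hS.isCompact.inter hS₁.isCompact)
    ⟨x, hS.left_mem, hS₁.left_mem⟩ x
  have hwz : dist x w ≤ dist x z := by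
    have := hS.dist_add hwS
    have := dist_nonneg (x := w) (y := z)
    linarith
  obtain ⟨w', ⟨⟨hwS', hwS₂⟩, hww⟩, hw'⟩ := exists_nearest
    ((hS.isCompact.inter hS₂.isCompact).inter_right (isClosed_le_dist x (dist x w)))
    ⟨z, ⟨hS.right_mem, hS₂.right_mem⟩, hwz⟩ x
  simp only [mem_ofPred_eq] at hww
  have hwS₂_eq (h : w ∈ S₂) : w = w' :=
    hS.eq_of_dist_eq hwS hwS' (le_antisymm hww (hw' w ⟨⟨hwS, h⟩, le_refl (dist x w)⟩))
  by_cases heq : w = w'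
  · subst heq
    have hA := (hS.initial_sub hwS).union (hS₁.symm.initial_sub hwS₁).symm (hS₁.dist_add hwS₁)
    have hB := (hS₂.initial_sub hwS₂).union (hS.sub hwS hS.right_mem hwz) (hS₂.dist_add hwS₂)
    have hAp := hy _ hA p hp
    have hBp := hz _ hB p hp
    have le_end {v : F} (hv : v ∈ S) : dist x v ≤ dist x z := by
      have := hS.dist_add hv
      have := dist_nonneg (x := v) (y := z)
      linarith
    have key (u v : F) (hu : u ∈ S ∩ p) (hv : v ∈ S ∩ p) (huv : dist x u ≤ dist x v) :
        u = v := by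
      rcases le_total (dist x v) (dist x w) with h | h
      · exact hAp ⟨.inl ⟨hu.1, huv.trans h⟩, hu.2⟩ ⟨.inl ⟨hv.1, h⟩, hv.2⟩
      rcases le_total (dist x w) (dist x u) with h' | h'
      · exact hBp ⟨.inr ⟨hu.1, h', le_end hu.1⟩, hu.2⟩ ⟨.inr ⟨hv.1, h, le_end hv.1⟩, hv.2⟩
      have hwp : w ∈ p :=
        isSegment_subset_piece hP hp hu.2 hv.2 (hS.sub hu.1 hv.1 huv) ⟨hwS, h', h⟩
      exact (hAp ⟨.inl ⟨hu.1, h'⟩, hu.2⟩ ⟨.inl ⟨hwS, le_rfl⟩, hwp⟩).trans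
        (hBp ⟨.inr ⟨hwS, le_rfl, hwz⟩, hwp⟩ ⟨.inr ⟨hv.1, h, le_end hv.1⟩, hv.2⟩)
    intro u hu v hv
    rcases le_total (dist x u) (dist x v) with h | h
    · exact key u v hu hv h
    · exact (key v u hv hu h).symm
  · exfalso
    have hM₁ := hS₁.symm.initial_sub hwS₁
    have hM₂ := hS₂.initial_sub hwS₂
    obtain ⟨y', ⟨hy₁, hy₂⟩, hymax⟩ := exists_farthest (hM₁.isCompact.inter hM₂.isCompact)
      ⟨y, hM₁.left_mem, hM₂.left_mem⟩ y
    have hwy : w ≠ y' := by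
      rintro rfl
      exact heq (hwS₂_eq hy₂.1)
    have hN₁ := (hM₁.sub hy₁ hM₁.right_mem hy₁.2).symm
    obtain ⟨q, hq, hq1, -, -⟩ := exists_piece_of_triangle hP hN₁
      (hM₂.sub hy₂ hM₂.right_mem hy₂.2) (hS.sub hwS hwS' hww).symm hwy
      (fun v hv₁ hv₂ => hM₂.eq_of_dist_eq hv₂.1 hy₂
        (le_antisymm (hymax v ⟨hv₁.1, hv₂.1⟩) hv₂.2.1))
      (fun v hv₂ hv => hS.eq_of_dist_eq hv.1 hwS'
        (le_antisymm hv.2.2 (hw' v ⟨⟨hv.1, hv₂.1.1⟩, hv.2.1⟩)))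
      (fun v hv hv₁ => .inl (hS.eq_of_dist_eq hv.1 hwS
        (le_antisymm (hw v ⟨hv.1, hv₁.1.1⟩) hv.2.1)))
    exact hwy (hy S₁ hS₁ q hq ⟨hwS₁, hq1 hN₁.left_mem⟩ ⟨hy₁.1, hq1 hN₁.right_mem⟩)

theorem transversalTree_eq_of_mem (hF : GeodesicSpace F) (hP : IsTreeGraded P) {x y : F}
    (hy : y ∈ transversalTree P x) : transversalTree P x = transversalTree P y :=
  Subset.antisymm
    (fun _ hz => mem_transversalTree_trans hF hP (mem_transversalTree_symm hy) hz)
    (fun _ hz => mem_transversalTree_trans hF hP hy hz)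

end TreeGraded

/-- `F` is tree-graded with respect to `P` together with all transversal
trees: the enlarged collection satisfies (T₁) and (T₂). -/
theorem stmt_4 {F : Type*} [MetricSpace F] [CompleteSpace F] (hF : GeodesicSpace F)
    (P : Set (Set F)) (hTG : IsTreeGraded P) :
    (∀ A ∈ P ∪ {S | ∃ x : F, S = transversalTree P x},
     ∀ B ∈ P ∪ {S | ∃ x : F, S = transversalTree P x},
      A ≠ B → (A ∩ B).Subsingleton) ∧
    (∀ (γ : ℝ → F) (a b L : ℝ), SimpleGeodesicTriangle γ a b L →
      ∃ A ∈ P ∪ {S | ∃ x : F, S = transversalTree P x}, γ '' Set.Icc 0 L ⊆ A) := by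
  refine ⟨?_, fun γ a b L h => ?_⟩
  · rintro A (hA | ⟨x, rfl⟩) B (hB | ⟨y, rfl⟩) hAB
    · exact hTG.T1 A hA B hB hAB
    · exact TreeGraded.piece_inter_transversalTree hF hTG hA y
    · rw [Set.inter_comm]
      exact TreeGraded.piece_inter_transversalTree hF hTG hB x
    · rintro u ⟨hux, huy⟩
      exact (hAB ((TreeGraded.transversalTree_eq_of_mem hF hTG hux).trans
        (TreeGraded.transversalTree_eq_of_mem hF hTG huy).symm)).elim
  · obtain ⟨p, hp, hsub⟩ := hTG.T2 γ a b L h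
    exact ⟨p, .inl hp, hsub⟩
end

section
/- The function D on the tree product ΠP satisfies the triangle inequality: for all f, g, h ∈ ΠP, D(f,g) ≤ D(f,h) + D(h,g). Together with symmetry and the fact that D(f,g) = 0 iff f = g, D is a metric on ΠP. -/
open scoped Classical

/-- The set `Ω`: pairs of (distinct) points coming from one of the spaces `M i`. -/
abbrev PairVal (I : Type*) (M : I → Type*) := Σ i : I, M i × M i

/-- An element of the tree product `ΠP` of the family of metric spaces `M i`:
a partial function from a dense open subset of `]0, d[` to `Ω`, encoded as an
`Option`-valued function, satisfying conditions (Π₁)–(Π₅). -/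
structure TreeProdFun (I : Type*) (M : I → Type*) [∀ i, MetricSpace (M i)] where
  /-- the length of the interval of definition -/
  d : ℝ
  d_nonneg : 0 ≤ d
  /-- the partial function; `none` outside the domain -/
  f : ℝ → Option (PairVal I M)
  /-- (Π₁) the domain is contained in `]0, d[` … -/
  dom_sub : ∀ t : ℝ, (f t).isSome → t ∈ Set.Ioo 0 d
  /-- … it is open … -/
  dom_open : IsOpen {t : ℝ | (f t).isSome = true}
  /-- … and dense in `]0, d[`. -/
  dom_dense : Set.Ioo 0 d ⊆ closure {t : ℝ | (f t).isSome = true}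
  /-- values are pairs of *distinct* points -/
  distinct : ∀ t i (x y : M i), f t = some ⟨i, (x, y)⟩ → x ≠ y
  /-- (Π₂) `f` is locally constant on its domain -/
  locConst : ∀ t : ℝ, (f t).isSome → ∀ᶠ s in nhds t, f s = f t
  /-- (Π₃) on a maximal subinterval of the domain with value `(x,y)`, the length of the
  interval equals `dist x y` -/
  intervalLen : ∀ a b : ℝ, a < b → (∀ t ∈ Set.Ioo a b, (f t).isSome) →
    ¬ (f a).isSome → ¬ (f b).isSome →
    ∀ t ∈ Set.Ioo a b, ∀ i (x y : M i), f t = some ⟨i, (x, y)⟩ → dist x y = b - a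
  /-- (Π₄) no fake exits: no two consecutive values of the form `(x₁,x₂), (x₂,x₃)` -/
  noFakeExit : ∀ a b c : ℝ, a < b → b < c →
    (∀ t ∈ Set.Ioo a b, (f t).isSome) → (∀ t ∈ Set.Ioo b c, (f t).isSome) →
    ¬ (f a).isSome → ¬ (f b).isSome → ¬ (f c).isSome →
    ∀ s ∈ Set.Ioo a b, ∀ t ∈ Set.Ioo b c, ∀ i (x y z w : M i),
      f s = some ⟨i, (x, y)⟩ → f t = some ⟨i, (z, w)⟩ → y ≠ z
  /-- (Π₅) no backtracking: `f` never coincides on `]p-q, p+q[` with its reflection at `p`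
  composed with swapping the components of the values -/
  noBacktrack : ∀ p q : ℝ, 0 < q → Set.Ioo (p - q) (p + q) ⊆ Set.Ioo 0 d →
    ¬ ∀ t ∈ Set.Ioo (p - q) (p + q),
        f t = Option.map (fun v : PairVal I M => ⟨v.1, (v.2.2, v.2.1)⟩) (f (2 * p - t))

variable {I : Type*} {M : I → Type*} [∀ i, MetricSpace (M i)]

/-- The domain `A_f` of an element of the tree product. -/
def TreeProdFun.dom (f : TreeProdFun I M) : Set ℝ := {t : ℝ | (f.f t).isSome}

/-- The empty function `f_∅`. -/
def emptyTPF (I : Type*) (M : I → Type*) [∀ i, MetricSpace (M i)] : TreeProdFun I M where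
  d := 0
  d_nonneg := le_refl 0
  f := fun _ => none
  dom_sub := by intro t h; simp at h
  dom_open := by simp
  dom_dense := by simp
  distinct := by intro t i x y h; cases h
  locConst := by intro t h; simp at h
  intervalLen := by intro a b _ _ _ _ t ht i x y h; cases h
  noFakeExit := by intro a b c _ _ _ _ _ _ _ s hs t ht i x y z w h; cases h
  noBacktrack := by
    intro p q hq hsub _
    have hp : p ∈ Set.Ioo (p - q) (p + q) := by constructor <;> linarith
    have := hsub hp
    simp at this

/-- The divergence point `div(f,g)`: the supremum of all `s` such that the restrictions of
`f` and `g` to `]0,s[ ∩ A_f` coincide. -/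
noncomputable def divPt (f g : TreeProdFun I M) : ℝ :=
  sSup {s : ℝ | 0 ≤ s ∧ s ≤ min f.d g.d ∧
    ∀ t ∈ Set.Ioo (0 : ℝ) s, (f.f t).isSome → f.f t = g.f t}

/-- `afterPt f s` is the right endpoint of the maximal (possibly empty) interval
`]s, a[` contained in the domain of `f`; it equals `s` if there is no such interval. -/
noncomputable def afterPt (f : TreeProdFun I M) (s : ℝ) : ℝ :=
  sSup {b : ℝ | s ≤ b ∧ b ≤ max s f.d ∧ ∀ t ∈ Set.Ioo s b, (f.f t).isSome}

/-- Distance between the second coordinates of two values in `Ω` (0 if undefined or in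
different spaces; only used when the indices agree). -/
noncomputable def optSndDist : Option (PairVal I M) → Option (PairVal I M) → ℝ
  | some ⟨i, (_, y)⟩, some ⟨j, (_, w)⟩ =>
      if h : i = j then dist (cast (congrArg M h) y) w else 0
  | _, _ => 0

/-- The two values are defined and have the same first coordinate (`x_g(f) = x_f(g)`). -/
def sameStart : Option (PairVal I M) → Option (PairVal I M) → Prop
  | some ⟨i, (x, _)⟩, some ⟨j, (z, _)⟩ => ∃ h : i = j, cast (congrArg M h) x = z
  | _, _ => False

/-- The distance function `D` on the tree product, defined case-wise: in type 1
(both functions continue after the divergence point in the same piece through the same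
entrance point) via the exit points, in type 2 via the divergence point. -/
noncomputable def Dtp (f g : TreeProdFun I M) : ℝ :=
  if divPt f g < afterPt f (divPt f g) ∧ divPt f g < afterPt g (divPt f g) ∧
      sameStart (f.f ((divPt f g + afterPt f (divPt f g)) / 2))
        (g.f ((divPt f g + afterPt g (divPt f g)) / 2))
  then (f.d - afterPt f (divPt f g)) + (g.d - afterPt g (divPt f g)) +
       optSndDist (f.f ((divPt f g + afterPt f (divPt f g)) / 2))
         (g.f ((divPt f g + afterPt g (divPt f g)) / 2))
  else (f.d - divPt f g) + (g.d - divPt f g)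

/-- `f.IsPiece s a v` says that `]s, a[` is a connected component of the domain of `f`,
on which `f` takes the value `v`. -/
structure TreeProdFun.IsPiece (f : TreeProdFun I M) (s a : ℝ) (v : PairVal I M) : Prop where
  lt : s < a
  nonneg : 0 ≤ s
  le_d : a ≤ f.d
  left_none : f.f s = none
  right_none : f.f a = none
  eq_some : ∀ t ∈ Set.Ioo s a, f.f t = some v

theorem TreeProdFun.eq_none_of_notMem (f : TreeProdFun I M) {t : ℝ} (ht : t ∉ Set.Ioo 0 f.d) :
    f.f t = none := by
  by_contra h
  exact ht (f.dom_sub t (Option.isSome_iff_ne_none.2 h))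

theorem TreeProdFun.eq_of_forall_isSome (f : TreeProdFun I M) {a b s t : ℝ}
    (h : ∀ r ∈ Set.Ioo a b, (f.f r).isSome) (hs : s ∈ Set.Ioo a b) (ht : t ∈ Set.Ioo a b) :
    f.f s = f.f t := by
  refine isPreconnected_Ioo.induction₂ (fun x y => f.f x = f.f y) ?_ ?_ ?_ hs ht
  · intro x hx
    filter_upwards [mem_nhdsWithin_of_mem_nhds (f.locConst x (h x hx))] with y hy using hy.symm
  · exact fun _ _ _ _ _ _ h₁ h₂ => h₁.trans h₂
  · exact fun _ _ _ _ h => h.symm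

theorem TreeProdFun.IsPiece.length {f : TreeProdFun I M} {s a : ℝ} {v : PairVal I M}
    (h : f.IsPiece s a v) : dist v.2.1 v.2.2 = a - s := by
  have hm : (s + a) / 2 ∈ Set.Ioo s a := by constructor <;> linarith [h.lt]
  exact f.intervalLen s a h.lt (fun t ht => by simp [h.eq_some t ht]) (by simp [h.left_none])
    (by simp [h.right_none]) _ hm v.1 v.2.1 v.2.2 (h.eq_some _ hm)

/-- Every point of the domain lies in a component of the domain. -/
theorem TreeProdFun.exists_isPiece (f : TreeProdFun I M) {t : ℝ} {v : PairVal I M}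
    (ht : f.f t = some v) : ∃ s a, s < t ∧ t < a ∧ f.IsPiece s a v := by
  have ht0 := f.dom_sub t (by simp [ht])
  have hclosed : IsClosed {r : ℝ | f.f r = none} := by
    convert f.dom_open.isClosed_compl using 1
    ext r
    simp
  set L := {r : ℝ | f.f r = none} ∩ Set.Iic t with hL
  set R := {r : ℝ | f.f r = none} ∩ Set.Ici t with hR
  have h0L : (0 : ℝ) ∈ L := ⟨f.eq_none_of_notMem (by simp), ht0.1.le⟩
  have hdR : f.d ∈ R := ⟨f.eq_none_of_notMem (by simp), ht0.2.le⟩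
  have bL : BddAbove L := ⟨t, fun r hr => hr.2⟩
  have bR : BddBelow R := ⟨t, fun r hr => hr.2⟩
  have hs := (hclosed.inter isClosed_Iic).csSup_mem ⟨0, h0L⟩ bL
  have ha := (hclosed.inter isClosed_Ici).csInf_mem ⟨f.d, hdR⟩ bR
  rw [← hL] at hs
  rw [← hR] at ha
  have hst : sSup L < t := lt_of_le_of_ne hs.2 fun e => by
    have := hs.1
    simp [e, ht] at this
  have hta : t < sInf R := lt_of_le_of_ne ha.2 fun e => by
    have := ha.1
    simp [← e, ht] at this
  have hdom : ∀ r ∈ Set.Ioo (sSup L) (sInf R), (f.f r).isSome := by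
    intro r hr
    by_contra hn
    have hn : f.f r = none := by simpa using hn
    rcases le_total r t with h | h
    · exact absurd (le_csSup bL ⟨hn, h⟩) (not_le.2 hr.1)
    · exact absurd (csInf_le bR ⟨hn, h⟩) (not_le.2 hr.2)
  exact ⟨sSup L, sInf R, hst, hta, hst.trans hta, le_csSup bL h0L, csInf_le bR hdR, hs.1, ha.1,
    fun r hr => (f.eq_of_forall_isSome hdom hr ⟨hst, hta⟩).trans ht⟩

theorem TreeProdFun.IsPiece.afterPt_eq {f : TreeProdFun I M} {s a : ℝ} {v : PairVal I M}
    (h : f.IsPiece s a v) : afterPt f s = a := by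
  refine IsGreatest.csSup_eq ⟨⟨h.lt.le, h.le_d.trans (le_max_right _ _), ?_⟩, ?_⟩
  · intro t ht
    simp [h.eq_some t ht]
  · rintro b ⟨-, -, hb⟩
    by_contra! hab
    simpa [h.right_none] using hb a ⟨h.lt, hab⟩

theorem TreeProdFun.IsPiece.unique {f : TreeProdFun I M} {s a b : ℝ} {v w : PairVal I M}
    (h : f.IsPiece s a v) (h' : f.IsPiece s b w) : a = b ∧ v = w := by
  have hab : a = b := h.afterPt_eq.symm.trans h'.afterPt_eq
  subst hab
  have hm : (s + a) / 2 ∈ Set.Ioo s a := by constructor <;> linarith [h.lt]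
  exact ⟨rfl, Option.some.inj ((h.eq_some _ hm).symm.trans (h'.eq_some _ hm))⟩

theorem TreeProdFun.exists_isPiece_afterPt {f : TreeProdFun I M} {s : ℝ} (hs : f.f s = none)
    (h : s < afterPt f s) : ∃ v, f.IsPiece s (afterPt f s) v := by
  obtain ⟨b, ⟨-, -, hb⟩, hsb⟩ := exists_lt_of_lt_csSup
    (s := {b : ℝ | s ≤ b ∧ b ≤ max s f.d ∧ ∀ t ∈ Set.Ioo s b, (f.f t).isSome})
    ⟨s, le_rfl, le_max_left _ _, by simp⟩ h
  have hm : (s + b) / 2 ∈ Set.Ioo s b := by constructor <;> linarith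
  obtain ⟨v, hv⟩ := Option.isSome_iff_exists.1 (hb _ hm)
  obtain ⟨p, a, hpm, hma, hp⟩ := f.exists_isPiece hv
  have hps : p = s := by
    rcases lt_trichotomy p s with h | h | h
    · have := hp.eq_some s ⟨h, hm.1.trans hma⟩
      simp [hs] at this
    · exact h
    · have := hb p ⟨h, hpm.trans hm.2⟩
      simp [hp.left_none] at this
  subst hps
  exact ⟨v, by rwa [hp.afterPt_eq]⟩

/-- `f` and `g` coincide on `]0, s[`, where `s` is at most both lengths. -/
structure TreeProdFun.Agree (f g : TreeProdFun I M) (s : ℝ) : Prop where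
  nonneg : 0 ≤ s
  le_left : s ≤ f.d
  le_right : s ≤ g.d
  eq : ∀ t ∈ Set.Ioo 0 s, f.f t = g.f t

namespace TreeProdFun.Agree

variable {f g h : TreeProdFun I M} {s r : ℝ}

theorem symm (H : f.Agree g s) : g.Agree f s :=
  ⟨H.nonneg, H.le_right, H.le_left, fun t ht => (H.eq t ht).symm⟩

theorem trans (H : f.Agree g s) (H' : g.Agree h s) : f.Agree h s :=
  ⟨H.nonneg, H.le_left, H'.le_right, fun t ht => (H.eq t ht).trans (H'.eq t ht)⟩

theorem mono (H : f.Agree g s) (hr : 0 ≤ r) (hrs : r ≤ s) : f.Agree g r :=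
  ⟨hr, hrs.trans H.le_left, hrs.trans H.le_right, fun t ht => H.eq t ⟨ht.1, ht.2.trans_le hrs⟩⟩

theorem isPiece (H : f.Agree g s) {p a : ℝ} {v : PairVal I M} (hp : f.IsPiece p a v)
    (hps : p < s) : g.IsPiece p a v := by
  obtain ⟨t, hpt, ht⟩ := exists_between (lt_min hp.lt hps)
  have hta := ht.trans_le (min_le_left _ _)
  have hts := ht.trans_le (min_le_right _ _)
  have hgt : g.f t = some v :=
    (H.eq t ⟨hp.nonneg.trans_lt hpt, hts⟩).symm.trans (hp.eq_some t ⟨hpt, hta⟩)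
  have hgp : g.f p = none := by
    rcases hp.nonneg.eq_or_lt with h0 | h0
    · exact g.eq_none_of_notMem (by simp [← h0])
    · rw [← H.eq p ⟨h0, hps⟩, hp.left_none]
  obtain ⟨q, b, hqt, htb, hq⟩ := g.exists_isPiece hgt
  have hqp : q = p := by
    rcases lt_trichotomy q p with h | h | h
    · have := hq.eq_some p ⟨h, hpt.trans htb⟩
      simp [hgp] at this
    · exact h
    · have h1 := hp.eq_some q ⟨h, hqt.trans hta⟩
      rw [H.eq q ⟨hp.nonneg.trans_lt h, hqt.trans hts⟩, hq.left_none] at h1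
      simp at h1
  subst hqp
  have hab : a = b := by linarith [hp.length, hq.length]
  rwa [hab]

theorem extend (H : f.Agree g s) {p a : ℝ} {v : PairVal I M} (hf : f.IsPiece p a v)
    (hg : g.IsPiece p a v) (hps : p ≤ s) : f.Agree g (max s a) := by
  refine ⟨H.nonneg.trans (le_max_left _ _), max_le H.le_left hf.le_d,
    max_le H.le_right hg.le_d, fun t ht => ?_⟩
  rcases lt_or_ge t s with h | h
  · exact H.eq t ⟨ht.1, h⟩
  · have hta : t < a := (lt_max_iff.1 ht.2).resolve_left h.not_gt
    rcases (hps.trans h).eq_or_lt with e | hpt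
    · rw [← e, hf.left_none, hg.left_none]
    · rw [hf.eq_some t ⟨hpt, hta⟩, hg.eq_some t ⟨hpt, hta⟩]

end TreeProdFun.Agree

/-- If `f` and `g` coincide on the part of the domain of `f` before `s`, then they coincide
everywhere before `s`, since the lengths of the components are determined by the values. -/
theorem TreeProdFun.agree_iff {f g : TreeProdFun I M} {s : ℝ} :
    f.Agree g s ↔ 0 ≤ s ∧ s ≤ min f.d g.d ∧
      ∀ t ∈ Set.Ioo (0 : ℝ) s, (f.f t).isSome → f.f t = g.f t := by
  refine ⟨fun H => ⟨H.nonneg, le_min H.le_left H.le_right, fun t ht _ => H.eq t ht⟩, ?_⟩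
  rintro ⟨h0, hs, hfg⟩
  refine ⟨h0, hs.trans (min_le_left _ _), hs.trans (min_le_right _ _), fun t ht => ?_⟩
  by_cases hft : (f.f t).isSome
  · exact hfg t ht hft
  have hft : f.f t = none := by simpa using hft
  rw [hft]
  by_contra hgt
  obtain ⟨v, hv⟩ := Option.ne_none_iff_exists'.1 (Ne.symm hgt)
  obtain ⟨q, b, hqt, htb, hq⟩ := g.exists_isPiece hv
  obtain ⟨m, hqm, hmt⟩ := exists_between hqt
  have hmd : m ∈ Set.Ioo 0 f.d :=
    ⟨hq.nonneg.trans_lt hqm, (hmt.trans ht.2).trans_le (hs.trans (min_le_left _ _))⟩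
  obtain ⟨r, hr, hrf⟩ := mem_closure_iff.1 (f.dom_dense hmd) (Set.Ioo q t) isOpen_Ioo ⟨hqm, hmt⟩
  have hrs : r ∈ Set.Ioo 0 s := ⟨hq.nonneg.trans_lt hr.1, hr.2.trans ht.2⟩
  have hfr : f.f r = some v :=
    (hfg r hrs hrf).trans (hq.eq_some r ⟨hr.1, hr.2.trans htb⟩)
  obtain ⟨p, a, hpr, hra, hp⟩ := f.exists_isPiece hfr
  have hat : a ≤ t := by
    by_contra! h
    have := hp.eq_some t ⟨hpr.trans hr.2, h⟩
    simp [hft] at this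
  have hqp : q ≤ p := by
    by_contra! h
    have h1 := hp.eq_some q ⟨h, hr.1.trans hra⟩
    have h2 := hfg q ⟨hp.nonneg.trans_lt h, hqt.trans ht.2⟩ (by simp [h1])
    rw [h1, hq.left_none] at h2
    simp at h2
  linarith [hp.length, hq.length]

theorem divPt_eq_sSup_agree (f g : TreeProdFun I M) : divPt f g = sSup {s | f.Agree g s} := by
  simp only [TreeProdFun.agree_iff, divPt]

theorem divPt_comm (f g : TreeProdFun I M) : divPt f g = divPt g f := by
  rw [divPt_eq_sSup_agree, divPt_eq_sSup_agree]
  congr 1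
  ext s
  exact ⟨fun H => H.symm, fun H => H.symm⟩

theorem TreeProdFun.Agree.le_divPt {f g : TreeProdFun I M} {s : ℝ} (H : f.Agree g s) :
    s ≤ divPt f g := by
  rw [divPt_eq_sSup_agree]
  exact le_csSup ⟨f.d, fun r hr => hr.le_left⟩ H

theorem agree_divPt (f g : TreeProdFun I M) : f.Agree g (divPt f g) := by
  have h0 : f.Agree g 0 := ⟨le_rfl, f.d_nonneg, g.d_nonneg, by simp⟩
  have hne : {s | f.Agree g s}.Nonempty := ⟨0, h0⟩
  refine ⟨h0.le_divPt, ?_, ?_, fun t ht => ?_⟩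
  · rw [divPt_eq_sSup_agree]
    exact csSup_le hne fun r hr => hr.le_left
  · rw [divPt_eq_sSup_agree]
    exact csSup_le hne fun r hr => hr.le_right
  · rw [divPt_eq_sSup_agree] at ht
    obtain ⟨r, hr, htr⟩ := exists_lt_of_lt_csSup hne ht.2
    exact TreeProdFun.Agree.eq hr t ⟨ht.1, htr⟩

theorem TreeProdFun.IsPiece.le_divPt {f g : TreeProdFun I M} {p a : ℝ} {v : PairVal I M}
    (hp : f.IsPiece p a v) (h : p < divPt f g) : a ≤ divPt f g :=
  (le_max_right _ _).trans
    ((agree_divPt f g).extend hp ((agree_divPt f g).isPiece hp h) h.le).le_divPt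

theorem apply_divPt_left (f g : TreeProdFun I M) : f.f (divPt f g) = none := by
  by_contra h
  obtain ⟨v, hv⟩ := Option.ne_none_iff_exists'.1 h
  obtain ⟨p, a, hps, hsa, hp⟩ := f.exists_isPiece hv
  exact absurd (hp.le_divPt hps) (not_le.2 hsa)

theorem apply_divPt_right (f g : TreeProdFun I M) : g.f (divPt f g) = none := by
  rw [divPt_comm, apply_divPt_left]

/-- The components of the domains of `f` and `g` starting at `s` exist and have values with
the same entrance point. -/
def SharedStart (f g : TreeProdFun I M) (s : ℝ) : Prop :=
  ∃ (i : I) (x y z : M i) (a b : ℝ), f.IsPiece s a ⟨i, (x, y)⟩ ∧ g.IsPiece s b ⟨i, (x, z)⟩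

theorem SharedStart.symm {f g : TreeProdFun I M} {s : ℝ} (H : SharedStart f g s) :
    SharedStart g f s := by
  obtain ⟨i, x, y, z, a, b, hf, hg⟩ := H
  exact ⟨i, x, z, y, b, a, hg, hf⟩

theorem SharedStart.exists_trans {f g h : TreeProdFun I M} {s : ℝ} (H : SharedStart f g s)
    (H' : SharedStart g h s) : ∃ (i : I) (x y z w : M i) (a b c : ℝ),
      f.IsPiece s a ⟨i, (x, y)⟩ ∧ g.IsPiece s b ⟨i, (x, z)⟩ ∧ h.IsPiece s c ⟨i, (x, w)⟩ := by
  obtain ⟨i, x, y, z, a, b, hf, hg⟩ := H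
  obtain ⟨j, x', z', w, b', c, hg', hh⟩ := H'
  obtain ⟨-, e⟩ := hg.unique hg'
  cases e
  exact ⟨i, x, y, z, w, a, b, c, hf, hg, hh⟩

theorem SharedStart.trans {f g h : TreeProdFun I M} {s : ℝ} (H : SharedStart f g s)
    (H' : SharedStart g h s) : SharedStart f h s := by
  obtain ⟨i, x, y, z, w, a, b, c, hf, -, hh⟩ := H.exists_trans H'
  exact ⟨i, x, y, w, a, c, hf, hh⟩

theorem Dtp_of_isPiece {f g : TreeProdFun I M} {i : I} {x y z : M i} {a b : ℝ}
    (hf : f.IsPiece (divPt f g) a ⟨i, (x, y)⟩) (hg : g.IsPiece (divPt f g) b ⟨i, (x, z)⟩) :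
    Dtp f g = (f.d - a) + (g.d - b) + dist y z := by
  have h1 := hf.eq_some ((divPt f g + a) / 2) (by constructor <;> linarith [hf.lt])
  have h2 := hg.eq_some ((divPt f g + b) / 2) (by constructor <;> linarith [hg.lt])
  rw [Dtp, hf.afterPt_eq, hg.afterPt_eq, h1, h2, if_pos ⟨hf.lt, hg.lt, rfl, rfl⟩]
  simp [optSndDist]

theorem Dtp_of_not_sharedStart {f g : TreeProdFun I M} (H : ¬ SharedStart f g (divPt f g)) :
    Dtp f g = (f.d - divPt f g) + (g.d - divPt f g) := by
  rw [Dtp, if_neg]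
  rintro ⟨hf, hg, hs⟩
  obtain ⟨⟨i, x, y⟩, hf⟩ := TreeProdFun.exists_isPiece_afterPt (apply_divPt_left f g) hf
  obtain ⟨⟨j, z, w⟩, hg⟩ := TreeProdFun.exists_isPiece_afterPt (apply_divPt_right f g) hg
  rw [hf.eq_some _ (by constructor <;> linarith [hf.lt]),
    hg.eq_some _ (by constructor <;> linarith [hg.lt])] at hs
  obtain ⟨e, hxz⟩ := hs
  cases e
  cases hxz
  exact H ⟨i, x, y, w, _, _, hf, hg⟩

theorem Dtp_comm (f g : TreeProdFun I M) : Dtp f g = Dtp g f := by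
  by_cases H : SharedStart f g (divPt f g)
  · obtain ⟨i, x, y, z, a, b, hf, hg⟩ := H
    rw [Dtp_of_isPiece hf hg]
    rw [divPt_comm] at hf hg
    rw [Dtp_of_isPiece hg hf, dist_comm]
    ring
  · rw [Dtp_of_not_sharedStart H]
    rw [divPt_comm] at H ⊢
    rw [Dtp_of_not_sharedStart fun H' => H H'.symm]
    ring

/-- For pieces starting at the same point with the same entrance point, the exit points are
related to the exit times by the triangle inequality. -/
theorem TreeProdFun.IsPiece.dist_bounds {f g : TreeProdFun I M} {i : I} {x y z : M i}
    {s a b : ℝ} (hf : f.IsPiece s a ⟨i, (x, y)⟩) (hg : g.IsPiece s b ⟨i, (x, z)⟩) :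
    dist y z ≤ (a - s) + (b - s) ∧ a - b ≤ dist y z ∧ b - a ≤ dist y z := by
  have h1 : dist x y = a - s := hf.length
  have h2 : dist x z = b - s := hg.length
  have h3 := dist_triangle_left y z x
  have h4 := dist_triangle x z y
  have h5 := dist_triangle x y z
  rw [dist_comm z y] at h4
  refine ⟨?_, ?_, ?_⟩ <;> linarith

theorem Dtp_le (f g : TreeProdFun I M) :
    Dtp f g ≤ (f.d - divPt f g) + (g.d - divPt f g) := by
  by_cases H : SharedStart f g (divPt f g)
  · obtain ⟨i, x, y, z, a, b, hf, hg⟩ := H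
    rw [Dtp_of_isPiece hf hg]
    linarith [(hf.dist_bounds hg).1]
  · rw [Dtp_of_not_sharedStart H]

theorem sub_le_Dtp (f g : TreeProdFun I M) : f.d - g.d ≤ Dtp f g := by
  by_cases H : SharedStart f g (divPt f g)
  · obtain ⟨i, x, y, z, a, b, hf, hg⟩ := H
    rw [Dtp_of_isPiece hf hg]
    linarith [(hf.dist_bounds hg).2.1, hg.le_d]
  · rw [Dtp_of_not_sharedStart H]
    linarith [(agree_divPt f g).le_right]

theorem TreeProdFun.Agree.divPt_eq {f g h : TreeProdFun I M} {r : ℝ} (H : f.Agree h r)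
    (hr : divPt f g < r) : divPt h g = divPt f g := by
  have hfg := agree_divPt f g
  have hhg := agree_divPt h g
  refine le_antisymm ?_ ((H.mono hfg.nonneg hr.le).symm.trans hfg).le_divPt
  by_contra! hlt
  have h0 : 0 ≤ min r (divPt h g) := le_min H.nonneg hhg.nonneg
  have := ((H.mono h0 (min_le_left _ _)).trans (hhg.mono h0 (min_le_right _ _))).le_divPt
  exact absurd this (not_le.2 (lt_min hr hlt))

/-- If `f` and `h` coincide beyond the divergence point of `f` and `g`, then the distances of
`f` and `h` to `g` differ by the difference of the lengths. -/
theorem TreeProdFun.Agree.Dtp_sub_eq {f g h : TreeProdFun I M} {r : ℝ} (H : f.Agree h r)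
    (hr : divPt f g < r) : Dtp f g - f.d = Dtp h g - h.d := by
  have e := H.divPt_eq hr
  by_cases S : SharedStart f g (divPt f g)
  · obtain ⟨i, x, y, z, a, b, hf, hg⟩ := S
    have hh := H.isPiece hf hr
    rw [Dtp_of_isPiece hf hg]
    rw [← e] at hh hg
    rw [Dtp_of_isPiece hh hg]
    ring
  · rw [Dtp_of_not_sharedStart S, Dtp_of_not_sharedStart, e]
    · ring
    · rintro ⟨i, x, y, z, a, b, hh, hg⟩
      rw [e] at hh hg
      exact S ⟨i, x, y, z, a, b, H.symm.isPiece hh hr, hg⟩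

theorem sub_divPt_le_Dtp {f g h : TreeProdFun I M} (hlt : divPt f h < divPt f g) :
    f.d - divPt f g ≤ Dtp f h := by
  by_cases S : SharedStart f h (divPt f h)
  · obtain ⟨i, x, y, z, a, b, hf, hh⟩ := S
    rw [Dtp_of_isPiece hf hh]
    linarith [hf.le_divPt hlt, hh.le_d, dist_nonneg (x := y) (y := z)]
  · rw [Dtp_of_not_sharedStart S]
    linarith [(agree_divPt f h).le_right]

theorem Dtp_triangle_of_divPt_eq {f g h : TreeProdFun I M} (h₁ : divPt f h = divPt f g)
    (h₂ : divPt h g = divPt f g) : Dtp f g ≤ Dtp f h + Dtp h g := by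
  have hd := (agree_divPt h g).le_left
  rw [h₂] at hd
  by_cases S₁ : SharedStart f h (divPt f g) <;> by_cases S₂ : SharedStart h g (divPt f g)
  · obtain ⟨i, x, y, z, w, a, b, c, hf, hh, hg⟩ := S₁.exists_trans S₂
    rw [Dtp_of_isPiece hf hg, Dtp_of_isPiece (f := f) (g := h) (h₁ ▸ hf) (h₁ ▸ hh),
      Dtp_of_isPiece (f := h) (g := g) (h₂ ▸ hh) (h₂ ▸ hg)]
    linarith [dist_triangle y z w, hh.le_d]
  · obtain ⟨i, x, y, z, a, b, hf, hh⟩ := S₁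
    rw [Dtp_of_isPiece (f := f) (g := h) (h₁ ▸ hf) (h₁ ▸ hh),
      Dtp_of_not_sharedStart (f := h) (g := g) (h₂ ▸ S₂), h₂]
    linarith [Dtp_le f g, (hf.dist_bounds hh).2.1, hh.le_d]
  · obtain ⟨i, x, y, z, a, b, hh, hg⟩ := S₂
    rw [Dtp_of_isPiece (f := h) (g := g) (h₂ ▸ hh) (h₂ ▸ hg),
      Dtp_of_not_sharedStart (f := f) (g := h) (h₁ ▸ S₁), h₁]
    linarith [Dtp_le f g, (hh.dist_bounds hg).2.2, hh.le_d]
  · rw [Dtp_of_not_sharedStart (f := f) (g := h) (h₁ ▸ S₁),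
      Dtp_of_not_sharedStart (f := h) (g := g) (h₂ ▸ S₂), h₁, h₂]
    linarith [Dtp_le f g]

theorem Dtp_triangle (f g h : TreeProdFun I M) : Dtp f g ≤ Dtp f h + Dtp h g := by
  rcases lt_or_ge (divPt f g) (divPt f h) with h₁ | h₁
  · linarith [(agree_divPt f h).Dtp_sub_eq h₁, sub_le_Dtp f h]
  rcases lt_or_ge (divPt f g) (divPt h g) with h₂ | h₂
  · rw [divPt_comm f g, divPt_comm h g] at h₂
    have := (agree_divPt g h).Dtp_sub_eq h₂
    rw [Dtp_comm f g, Dtp_comm f h, Dtp_comm h g]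
    linarith [sub_le_Dtp g h]
  rcases h₁.lt_or_eq with h₁ | h₁
  · have e := (agree_divPt f g).Dtp_sub_eq h₁
    rw [Dtp_comm h g]
    linarith [Dtp_le f g, sub_divPt_le_Dtp h₁]
  rcases h₂.lt_or_eq with h₂ | h₂
  · rw [divPt_comm f g, divPt_comm h g] at h₂
    have e := (agree_divPt g f).Dtp_sub_eq h₂
    rw [Dtp_comm h g]
    linarith [Dtp_le g f, Dtp_comm f g, sub_divPt_le_Dtp h₂]
  exact Dtp_triangle_of_divPt_eq h₁ h₂

theorem Dtp_self (f : TreeProdFun I M) : Dtp f f = 0 := by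
  have hd : divPt f f = f.d :=
    (agree_divPt f f).le_left.antisymm
      (TreeProdFun.Agree.le_divPt ⟨f.d_nonneg, le_rfl, le_rfl, fun _ _ => rfl⟩)
  have h1 := Dtp_le f f
  have h2 := sub_le_Dtp f f
  rw [hd] at h1
  linarith

theorem TreeProdFun.Agree.eq_of_length {f g : TreeProdFun I M} {s : ℝ} (H : f.Agree g s)
    (hf : f.d = s) (hg : g.d = s) : f = g := by
  have hfun : f.f = g.f := by
    funext t
    by_cases ht : t ∈ Set.Ioo 0 s
    · exact H.eq t ht
    · rw [f.eq_none_of_notMem (hf ▸ ht), g.eq_none_of_notMem (hg ▸ ht)]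
  have hd : f.d = g.d := hf.trans hg.symm
  cases f
  cases g
  cases hfun
  cases hd
  rfl

theorem eq_of_Dtp_eq_zero {f g : TreeProdFun I M} (h : Dtp f g = 0) : f = g := by
  have H := agree_divPt f g
  by_cases S : SharedStart f g (divPt f g)
  · obtain ⟨i, x, y, z, a, b, hf, hg⟩ := S
    rw [Dtp_of_isPiece hf hg] at h
    have hyz : dist y z = 0 := by
      linarith [hf.le_d, hg.le_d, dist_nonneg (x := y) (y := z)]
    obtain rfl := dist_eq_zero.1 hyz
    obtain rfl : a = b := by linarith [(hf.dist_bounds hg).2.1, (hf.dist_bounds hg).2.2]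
    have := (H.extend hf hg le_rfl).le_divPt
    exact absurd ((le_max_right _ _).trans this) (not_le.2 hf.lt)
  · rw [Dtp_of_not_sharedStart S] at h
    exact H.eq_of_length (by linarith [H.le_left, H.le_right])
      (by linarith [H.le_left, H.le_right])

/-- `D` is a metric on the tree product: it satisfies the triangle
inequality, is symmetric, and vanishes exactly on the diagonal. -/
theorem stmt_7 :
    (∀ f g h : TreeProdFun I M, Dtp f g ≤ Dtp f h + Dtp h g) ∧
    (∀ f g : TreeProdFun I M, Dtp f g = Dtp g f) ∧
    (∀ f g : TreeProdFun I M, Dtp f g = 0 ↔ f = g) := by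
  exact ⟨Dtp_triangle, Dtp_comm, fun f g => ⟨eq_of_Dtp_eq_zero, fun h => h ▸ Dtp_self f⟩⟩
end

section
/- The tree product ΠP is homogeneous: for every f ∈ ΠP there exists an isometry Φ_f of ΠP onto itself with Φ_f(f) equal to the empty function f_∅. -/
open scoped Classical

variable {I : Type*} {M : I → Type*} [∀ i, MetricSpace (M i)]

/-- A (not necessarily reduced) word: a partial function to pairs of points with domain in
`]0, d[`. -/
@[ext]
structure PathWord (I : Type*) (M : I → Type*) where
  /-- the length of the word -/
  d : ℝ
  d_nonneg : 0 ≤ d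
  /-- the partial function -/
  f : ℝ → Option (PairVal I M)
  dom_sub : ∀ t : ℝ, (f t).isSome → t ∈ Set.Ioo 0 d

namespace PathWord

/-- The swap of the two components of a value. -/
def swapVal {I : Type*} {M : I → Type*} (v : PairVal I M) : PairVal I M := ⟨v.1, (v.2.2, v.2.1)⟩

section Monoid

variable {I : Type*} {M : I → Type*}

lemma f_eq_none_of_le_zero (w : PathWord I M) {t : ℝ} (ht : t ≤ 0) : w.f t = none := by
  by_contra h
  have := w.dom_sub t (Option.isSome_iff_ne_none.2 h)
  exact absurd this.1 (not_lt.2 ht)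

lemma f_eq_none_of_ge (w : PathWord I M) {t : ℝ} (ht : w.d ≤ t) : w.f t = none := by
  by_contra h
  have := w.dom_sub t (Option.isSome_iff_ne_none.2 h)
  exact absurd this.2 (not_lt.2 ht)

instance : One (PathWord I M) where
  one := ⟨0, le_rfl, fun _ => none, fun t h => by simp at h⟩

noncomputable instance : Mul (PathWord I M) where
  mul u v :=
    { d := u.d + v.d
      d_nonneg := add_nonneg u.d_nonneg v.d_nonneg
      f := fun t => if t < u.d then u.f t else v.f (t - u.d)
      dom_sub := by
        intro t h
        have hu := u.d_nonneg
        have hv := v.d_nonneg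
        split_ifs at h with hlt
        · have := u.dom_sub t h
          exact ⟨this.1, by linarith [this.2]⟩
        · have := v.dom_sub _ h
          exact ⟨by linarith [this.1], by linarith [this.2]⟩ }

@[simp] lemma one_d : (1 : PathWord I M).d = 0 := rfl

@[simp] lemma one_f (t : ℝ) : (1 : PathWord I M).f t = none := rfl

@[simp] lemma mul_d (u v : PathWord I M) : (u * v).d = u.d + v.d := rfl

lemma mul_f (u v : PathWord I M) (t : ℝ) :
    (u * v).f t = if t < u.d then u.f t else v.f (t - u.d) := rfl

lemma mul_f_of_le (u v : PathWord I M) {t : ℝ} (ht : t ≤ u.d) : (u * v).f t = u.f t := by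
  rw [mul_f]
  split_ifs with h
  · rfl
  · rw [u.f_eq_none_of_ge (not_lt.1 h), v.f_eq_none_of_le_zero (by linarith)]

lemma mul_f_of_ge (u v : PathWord I M) {t : ℝ} (ht : u.d ≤ t) :
    (u * v).f t = v.f (t - u.d) := by
  rw [mul_f, if_neg (not_lt.2 ht)]

lemma mul_f_add (u v : PathWord I M) {t : ℝ} (ht : 0 ≤ t) : (u * v).f (u.d + t) = v.f t := by
  rw [mul_f_of_ge u v (by linarith), add_sub_cancel_left]

lemma mul_f_junction (u v : PathWord I M) : (u * v).f u.d = none := by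
  rw [mul_f_of_le u v le_rfl, u.f_eq_none_of_ge le_rfl]

lemma eq_one_of_d {w : PathWord I M} (h : w.d = 0) : w = 1 := by
  ext1
  · exact h
  · funext t
    rcases le_total t 0 with ht | ht
    · rw [w.f_eq_none_of_le_zero ht, one_f]
    · rw [w.f_eq_none_of_ge (by linarith), one_f]

lemma d_pos_of_ne_one {w : PathWord I M} (h : w ≠ 1) : 0 < w.d :=
  lt_of_le_of_ne w.d_nonneg fun h0 => h (eq_one_of_d h0.symm)

noncomputable instance : Monoid (PathWord I M) where
  mul_assoc u v w := by
    have hu := u.d_nonneg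
    have hv := v.d_nonneg
    ext1
    · simp [add_assoc]
    · funext t
      simp only [mul_f, mul_d]
      by_cases h1 : t < u.d
      · rw [if_pos (by linarith), if_pos h1, if_pos h1]
      · by_cases h2 : t < u.d + v.d
        · rw [if_pos h2, if_neg h1, if_neg h1, if_pos (by linarith)]
        · rw [if_neg h2, if_neg h1, if_neg (by linarith), sub_sub]
  one_mul u := by
    ext1
    · simp
    · funext t
      rw [mul_f]
      split_ifs with h
      · rw [u.f_eq_none_of_le_zero h.le, one_f]
      · simp
  mul_one u := by
    ext1
    · simp
    · funext t
      rw [mul_f]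
      split_ifs with h
      · rfl
      · rw [u.f_eq_none_of_ge (not_lt.1 h), one_f]

/-- The reversed word. -/
noncomputable def rev (w : PathWord I M) : PathWord I M where
  d := w.d
  d_nonneg := w.d_nonneg
  f := fun t => (w.f (w.d - t)).map swapVal
  dom_sub := by
    intro t h
    rw [Option.isSome_map] at h
    have := w.dom_sub _ h
    exact ⟨by linarith [this.2], by linarith [this.1]⟩

@[simp] lemma rev_d (w : PathWord I M) : w.rev.d = w.d := rfl

lemma rev_f (w : PathWord I M) (t : ℝ) : w.rev.f t = (w.f (w.d - t)).map swapVal := rfl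

@[simp] lemma rev_rev (w : PathWord I M) : w.rev.rev = w := by
  ext1
  · rfl
  · funext t
    rw [rev_f, rev_f, rev_d, sub_sub_cancel, Option.map_map]
    exact Option.map_id'

@[simp] lemma rev_one : (1 : PathWord I M).rev = 1 := rfl

@[simp] lemma rev_mul (u v : PathWord I M) : (u * v).rev = v.rev * u.rev := by
  ext1
  · simp [add_comm]
  · funext t
    rcases le_total t v.d with h | h
    · rw [mul_f_of_le _ _ (by simpa using h), rev_f, rev_f, mul_d,
        mul_f_of_ge u v (by linarith)]
      congr 2
      ring
    · rw [mul_f_of_ge _ _ (by simpa using h), rev_f, rev_f, mul_d,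
        mul_f_of_le u v (by linarith), rev_d]
      congr 2
      ring

lemma rev_eq_one {w : PathWord I M} : w.rev = 1 ↔ w = 1 :=
  ⟨fun h => by rw [← rev_rev w, h, rev_one], fun h => by rw [h, rev_one]⟩

lemma mul_inj_of_d_eq {u v u' v' : PathWord I M} (h : u * v = u' * v') (hd : u.d = u'.d) :
    u = u' ∧ v = v' := by
  have hD : (u * v).d = (u' * v').d := by rw [h]
  simp only [mul_d] at hD
  constructor
  · ext1
    · exact hd
    · funext t
      rcases le_total t u.d with ht | ht
      · rw [← mul_f_of_le u v ht, h, mul_f_of_le u' v' (by linarith)]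
      · rw [f_eq_none_of_ge _ ht, f_eq_none_of_ge _ (by linarith)]
  · ext1
    · linarith
    · funext t
      rcases le_total 0 t with ht | ht
      · rw [← mul_f_add u v ht, h, hd, mul_f_add u' v' ht]
      · rw [f_eq_none_of_le_zero _ ht, f_eq_none_of_le_zero _ ht]

lemma mul_left_cancel' {u v v' : PathWord I M} (h : u * v = u * v') : v = v' :=
  (mul_inj_of_d_eq h rfl).2

/-- A word can be cut at any point outside its domain. -/
lemma exists_cut (w : PathWord I M) {s : ℝ} (h0 : 0 ≤ s) (hs : s ≤ w.d) (hn : w.f s = none) :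
    ∃ a b : PathWord I M, w = a * b ∧ a.d = s := by
  refine ⟨⟨s, h0, fun t => if t < s then w.f t else none, ?_⟩,
    ⟨w.d - s, by linarith, fun t => if 0 < t then w.f (s + t) else none, ?_⟩, ?_, rfl⟩
  · intro t h
    split_ifs at h with hlt
    · exact ⟨(w.dom_sub t h).1, hlt⟩
    · simp at h
  · intro t h
    split_ifs at h with hlt
    · exact ⟨hlt, by linarith [(w.dom_sub _ h).2]⟩
    · simp at h
  · ext1
    · simp
    · funext t
      rw [mul_f]
      dsimp only
      by_cases h1 : t < s
      · rw [if_pos h1, if_pos h1]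
      · rw [if_neg h1]
        by_cases h2 : 0 < t - s
        · rw [if_pos h2, add_sub_cancel]
        · rw [if_neg h2, show t = s by linarith, hn]

lemma exists_common_left_factor {u v : PathWord I M} {s : ℝ} (h0 : 0 ≤ s) (hu : s ≤ u.d)
    (hv : s ≤ v.d) (hn : u.f s = none) (heq : ∀ t ∈ Set.Ioc 0 s, u.f t = v.f t) :
    ∃ a b c : PathWord I M, u = a * b ∧ v = a * c ∧ a.d = s := by
  have hn' : v.f s = none := by
    rcases h0.eq_or_lt with rfl | h
    · exact v.f_eq_none_of_le_zero le_rfl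
    · rw [← heq s ⟨h, le_rfl⟩, hn]
  obtain ⟨a, b, rfl, ha⟩ := exists_cut u h0 hu hn
  obtain ⟨a', c, rfl, ha'⟩ := exists_cut v h0 hv hn'
  refine ⟨a, b, c, rfl, ?_, ha⟩
  congr 1
  ext1
  · rw [ha, ha']
  · funext t
    rcases le_or_gt t 0 with ht | ht
    · rw [f_eq_none_of_le_zero _ ht, f_eq_none_of_le_zero _ ht]
    · rcases le_or_gt t s with hts | hts
      · have := heq t ⟨ht, hts⟩
        rw [mul_f_of_le _ _ (by linarith), mul_f_of_le _ _ (by linarith)] at this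
        exact this.symm
      · rw [f_eq_none_of_ge _ (by linarith), f_eq_none_of_ge _ (by linarith)]

/-- Equidivisibility of the monoid of words. -/
lemma exists_mul_of_d_le {u v u' v' : PathWord I M} (h : u * v = u' * v') (hd : u.d ≤ u'.d) :
    ∃ r, u' = u * r ∧ v = r * v' := by
  have hD : (u * v).d = (u' * v').d := by rw [h]
  simp only [mul_d] at hD
  have := v'.d_nonneg
  obtain ⟨r, v'', rfl, hr⟩ := exists_cut v (s := u'.d - u.d) (by linarith) (by linarith) (by
    rw [← mul_f_of_ge u v hd, h, mul_f_junction])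
  rw [← mul_assoc] at h
  obtain ⟨h1, h2⟩ := mul_inj_of_d_eq h (by simp [hr])
  exact ⟨r, h1.symm, by rw [h2]⟩

end Monoid

section Letter

/-- The word with a single value `(x, y)`, empty for `x = y`. -/
noncomputable def letter {i : I} (x y : M i) : PathWord I M where
  d := dist x y
  d_nonneg := dist_nonneg
  f := fun t => if t ∈ Set.Ioo 0 (dist x y) then some ⟨i, (x, y)⟩ else none
  dom_sub := by
    intro t h
    split_ifs at h with ht
    · exact ht
    · simp at h

@[simp] lemma letter_d {i : I} (x y : M i) : (letter x y : PathWord I M).d = dist x y := rfl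

lemma letter_f {i : I} {x y : M i} {t : ℝ} (ht : t ∈ Set.Ioo 0 (dist x y)) :
    (letter x y : PathWord I M).f t = some ⟨i, (x, y)⟩ := if_pos ht

@[simp] lemma rev_letter {i : I} (x y : M i) :
    (letter x y : PathWord I M).rev = letter y x := by
  ext1
  · simp [dist_comm]
  · funext t
    rw [rev_f]
    by_cases ht : t ∈ Set.Ioo 0 (dist y x)
    · rw [letter_f ht, letter_f]
      · rfl
      · rw [letter_d, dist_comm x y]
        exact ⟨by linarith [ht.2], by linarith [ht.1]⟩
    · simp only [letter]
      rw [if_neg ht, if_neg]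
      · rfl
      · rw [dist_comm x y]
        exact fun h => ht ⟨by linarith [h.2], by linarith [h.1]⟩

lemma letter_ne_one {i : I} {x y : M i} (h : x ≠ y) : (letter x y : PathWord I M) ≠ 1 := by
  intro h1
  have : (letter x y : PathWord I M).d = 0 := by rw [h1, one_d]
  exact h (dist_eq_zero.1 this)

lemma mul_letter_mul_f (a b : PathWord I M) {i : I} {x y : M i} {t : ℝ}
    (ht : t ∈ Set.Ioo a.d (a.d + dist x y)) :
    (a * (letter x y * b)).f t = some ⟨i, (x, y)⟩ := by
  rw [mul_f_of_ge _ _ ht.1.le, mul_f_of_le _ _ (by rw [letter_d]; linarith [ht.2]), letter_f]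
  exact ⟨by linarith [ht.1], by linarith [ht.2]⟩

/-- A factorization never cuts a letter. -/
lemma letter_not_cut {u v a b : PathWord I M} {i : I} {x y : M i}
    (h : u * v = a * (letter x y * b)) : u.d ≤ a.d ∨ a.d + dist x y ≤ u.d := by
  by_contra! hc
  have h1 := mul_letter_mul_f a b (x := x) (y := y) (t := u.d) ⟨hc.1, hc.2⟩
  rw [← h, mul_f_junction] at h1
  cases h1

lemma letter_inj {i j : I} {x y : M i} {z w : M j} {b c : PathWord I M} (hxy : x ≠ y)
    (hzw : z ≠ w) (h : letter x y * b = letter z w * c) :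
    (⟨i, (x, y)⟩ : PairVal I M) = ⟨j, (z, w)⟩ ∧ b = c := by
  have h1 := dist_pos.2 hxy
  have h2 := dist_pos.2 hzw
  have hm := lt_min h1 h2
  set m := min (dist x y) (dist z w) with hmdef
  have hm1 : m ≤ dist x y := min_le_left _ _
  have hm2 : m ≤ dist z w := min_le_right _ _
  have e1 := mul_letter_mul_f (1 : PathWord I M) b (x := x) (y := y) (t := m / 2)
    ⟨by simpa using hm, by simp; linarith⟩
  have e2 := mul_letter_mul_f (1 : PathWord I M) c (x := z) (y := w) (t := m / 2)
    ⟨by simpa using hm, by simp; linarith⟩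
  rw [h, e2, Option.some.injEq] at e1
  refine ⟨e1.symm, ?_⟩
  cases e1
  exact mul_left_cancel' h

end Letter

section Junction

/-- The concatenation `u * v` involves no reduction at the junction. -/
def Junc (u v : PathWord I M) : Prop :=
  (∀ u' r v', u = u' * r.rev → v = r * v' → r = 1) ∧
  ∀ (u' v' : PathWord I M) (i : I) (x y z : M i), x ≠ y → y ≠ z →
    u = u' * letter x y → v = letter y z * v' → False

lemma Junc.rev {u v : PathWord I M} (h : Junc u v) : Junc v.rev u.rev := by
  constructor
  · intro u' r v' h1 h2
    refine h.1 v'.rev r u'.rev ?_ ?_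
    · rw [← rev_rev u, h2, rev_mul]
    · rw [← rev_rev v, h1, rev_mul, rev_rev]
  · intro u' v' i x y z hxy hyz h1 h2
    refine h.2 v'.rev u'.rev i z y x hyz.symm hxy.symm ?_ ?_
    · rw [← rev_rev u, h2, rev_mul, rev_letter]
    · rw [← rev_rev v, h1, rev_mul, rev_letter]

lemma Junc.of_mul_right {u v w : PathWord I M} (h : Junc u (v * w)) : Junc u v :=
  ⟨fun u' r v' h1 h2 => h.1 u' r (v' * w) h1 (by rw [h2, mul_assoc]),
    fun u' v' i x y z hxy hyz h1 h2 =>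
      h.2 u' (v' * w) i x y z hxy hyz h1 (by rw [h2, mul_assoc])⟩

lemma Junc.of_mul_left {u v w : PathWord I M} (h : Junc (u * v) w) : Junc v w :=
  ⟨fun u' r v' h1 h2 => h.1 (u * u') r v' (by rw [h1, mul_assoc]) h2,
    fun u' v' i x y z hxy hyz h1 h2 =>
      h.2 (u * u') v' i x y z hxy hyz (by rw [h1, mul_assoc]) h2⟩

lemma Junc.mul_right {u v : PathWord I M} (h : Junc u v) (hv : v ≠ 1) (w : PathWord I M) :
    Junc u (v * w) := by
  have hpos := d_pos_of_ne_one hv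
  constructor
  · intro u' r v' h1 h2
    rcases le_total v.d r.d with hd | hd
    · obtain ⟨q, rfl, -⟩ := exists_mul_of_d_le h2 hd
      exact absurd (h.1 (u' * q.rev) v 1 (by rw [h1, rev_mul, mul_assoc]) (mul_one v).symm) hv
    · obtain ⟨q, rfl, -⟩ := exists_mul_of_d_le h2.symm hd
      exact h.1 u' r q h1 rfl
  · intro u' v' i x y z hxy hyz h1 h2
    have h2' : v * w = 1 * (letter y z * v') := by rw [one_mul, h2]
    rcases letter_not_cut h2' with hd | hd
    · rw [one_d] at hd
      linarith
    · rw [one_d, zero_add] at hd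
      obtain ⟨q, rfl, -⟩ := exists_mul_of_d_le h2.symm hd
      exact h.2 u' q i x y z hxy hyz h1 rfl

lemma Junc.mul_left {u v : PathWord I M} (h : Junc u v) (hu : u ≠ 1) (w : PathWord I M) :
    Junc (w * u) v := by
  have := (h.rev.mul_right (mt rev_eq_one.1 hu) w.rev).rev
  simpa using this

lemma junc_mul_letter_iff {u e : PathWord I M} {i : I} {x y : M i} (hyx : y ≠ x) :
    Junc (u * letter y x) e ↔
      ∀ (z : M i) (v' : PathWord I M), x ≠ z → e ≠ letter x z * v' := by
  constructor
  · rintro h z v' hxz rfl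
    exact h.2 u v' i y x z hyx hxz rfl rfl
  · intro h
    constructor
    · intro p r v' h1 h2
      by_contra hr
      have hpos := d_pos_of_ne_one hr
      have hd : (u * letter y x).d = (p * r.rev).d := by rw [h1]
      simp only [mul_d, letter_d, rev_d] at hd
      have h1' : p * r.rev = u * (letter y x * 1) := by rw [mul_one, h1]
      rcases letter_not_cut h1' with hc | hc
      · obtain ⟨q, rfl, hq⟩ := exists_mul_of_d_le h1' hc
        have hr' : r = letter x y * q.rev := by
          rw [← rev_rev r, hq, mul_one, rev_mul, rev_letter]
        exact h y (q.rev * v') hyx.symm (by rw [h2, hr', mul_assoc])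
      · linarith
    · intro u' v' j a b c hab hbc h1 h2
      have h3 : letter x y * u.rev = letter b a * u'.rev := by
        have := congrArg PathWord.rev h1
        simpa using this
      obtain ⟨h4, -⟩ := letter_inj hyx.symm hab.symm h3
      cases h4
      exact h c v' hbc h2

lemma Junc.replace_letter {u u' r e : PathWord I M} {i : I} {x y z : M i} (hyx : y ≠ x)
    (hzx : z ≠ x) (h : Junc (u * (letter y x * r)) e) : Junc (u' * (letter z x * r)) e := by
  by_cases hr : r = 1
  · subst hr
    rw [mul_one] at h ⊢
    rw [junc_mul_letter_iff hyx] at h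
    rwa [junc_mul_letter_iff hzx]
  · rw [← mul_assoc] at h ⊢
    exact h.of_mul_left.mul_left hr _

end Junction

section Red

/-- A reduced word. -/
structure Red (w : PathWord I M) : Prop where
  exists_letter : ∀ t, (w.f t).isSome → ∃ (a b : PathWord I M) (i : I) (x y : M i), x ≠ y ∧
    w = a * (letter x y * b) ∧ t ∈ Set.Ioo a.d (a.d + dist x y)
  dense : ∀ s t, 0 ≤ s → s < t → t ≤ w.d → ∃ r ∈ Set.Ioo s t, (w.f r).isSome
  no_fake : ∀ (a b : PathWord I M) (i : I) (x y z : M i), x ≠ y → y ≠ z →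
    w ≠ a * (letter x y * (letter y z * b))
  no_back : ∀ a r b : PathWord I M, w = a * (r.rev * (r * b)) → r = 1

lemma Red.rev {w : PathWord I M} (h : Red w) : Red w.rev := by
  constructor
  · intro t ht
    rw [rev_f, Option.isSome_map] at ht
    obtain ⟨a, b, i, x, y, hxy, hw, h1, h2⟩ := h.exists_letter _ ht
    refine ⟨b.rev, a.rev, i, y, x, hxy.symm, by rw [hw]; simp [mul_assoc], ?_⟩
    have hd : w.d = a.d + (dist x y + b.d) := by rw [hw]; simp
    rw [rev_d, dist_comm]
    constructor <;> linarith
  · intro s t hs hst ht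
    rw [rev_d] at ht
    obtain ⟨r, hr, hr'⟩ := h.dense (w.d - t) (w.d - s) (by linarith) (by linarith) (by linarith)
    refine ⟨w.d - r, ⟨by linarith [hr.2], by linarith [hr.1]⟩, ?_⟩
    rw [rev_f, sub_sub_cancel, Option.isSome_map]
    exact hr'
  · intro a b i x y z hxy hyz hw
    refine h.no_fake b.rev a.rev i z y x hyz.symm hxy.symm ?_
    rw [← rev_rev w, hw]
    simp [mul_assoc]
  · intro a r b hw
    refine h.no_back b.rev r a.rev ?_
    rw [← rev_rev w, hw]
    simp [mul_assoc]

lemma Red.left {u v : PathWord I M} (h : Red (u * v)) : Red u := by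
  have hv := v.d_nonneg
  constructor
  · intro t ht
    have htd := u.dom_sub t ht
    rw [← mul_f_of_le u v htd.2.le] at ht
    obtain ⟨a, b, i, x, y, hxy, hw, h1, h2⟩ := h.exists_letter _ ht
    rcases letter_not_cut hw with hc | hc
    · linarith [htd.2]
    · rw [← mul_assoc] at hw
      obtain ⟨q, rfl, -⟩ := exists_mul_of_d_le hw.symm (by simpa using hc)
      exact ⟨a, q, i, x, y, hxy, mul_assoc _ _ _, h1, h2⟩
  · intro s t hs hst ht
    obtain ⟨r, hr, hr'⟩ := h.dense s t hs hst (by rw [mul_d]; linarith)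
    refine ⟨r, hr, ?_⟩
    rwa [mul_f_of_le u v (by linarith [hr.2])] at hr'
  · rintro a b i x y z hxy hyz rfl
    exact h.no_fake a (b * v) i x y z hxy hyz (by simp only [mul_assoc])
  · rintro a r b rfl
    exact h.no_back a r (b * v) (by simp only [mul_assoc])

lemma Red.right {u v : PathWord I M} (h : Red (u * v)) : Red v := by
  have h' := h.rev
  rw [rev_mul] at h'
  simpa using h'.left.rev

lemma Red.junc {u v : PathWord I M} (h : Red (u * v)) : Junc u v := by
  constructor
  · rintro u' r v' rfl rfl
    exact h.no_back u' r v' (mul_assoc _ _ _)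
  · rintro u' v' i x y z hxy hyz rfl rfl
    exact h.no_fake u' v' i x y z hxy hyz (mul_assoc _ _ _)

lemma Red.mul {u v : PathWord I M} (hu : Red u) (hv : Red v) (h : Junc u v) : Red (u * v) := by
  have hud := u.d_nonneg
  constructor
  · intro t ht
    rcases le_total t u.d with htu | htu
    · rw [mul_f_of_le u v htu] at ht
      obtain ⟨a, b, i, x, y, hxy, rfl, ht'⟩ := hu.exists_letter t ht
      exact ⟨a, b * v, i, x, y, hxy, by simp only [mul_assoc], ht'⟩
    · rw [mul_f_of_ge u v htu] at ht
      obtain ⟨a, b, i, x, y, hxy, rfl, ht'⟩ := hv.exists_letter _ ht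
      refine ⟨u * a, b, i, x, y, hxy, by simp only [mul_assoc], ?_⟩
      rw [mul_d]
      constructor <;> linarith [ht'.1, ht'.2]
  · intro s t hs hst ht
    rw [mul_d] at ht
    rcases lt_or_ge s u.d with hsu | hsu
    · obtain ⟨r, hr, hr'⟩ := hu.dense s (min t u.d) hs (lt_min hst hsu) (min_le_right _ _)
      refine ⟨r, ⟨hr.1, hr.2.trans_le (min_le_left _ _)⟩, ?_⟩
      rwa [mul_f_of_le u v (hr.2.le.trans (min_le_right _ _))]
    · obtain ⟨r, hr, hr'⟩ := hv.dense (s - u.d) (t - u.d) (by linarith) (by linarith)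
        (by linarith)
      refine ⟨u.d + r, ⟨by linarith [hr.1], by linarith [hr.2]⟩, ?_⟩
      rwa [mul_f_add u v (by linarith [hr.1])]
  · intro a b i x y z hxy hyz hw
    rcases letter_not_cut hw with hc | hc
    · obtain ⟨q, rfl, rfl⟩ := exists_mul_of_d_le hw hc
      exact hv.no_fake q b i x y z hxy hyz rfl
    · rw [← mul_assoc] at hw
      rcases letter_not_cut hw with hc' | hc'
      · obtain ⟨h1, h2⟩ := mul_inj_of_d_eq hw
          (le_antisymm hc' (by simpa using hc))
        exact h.2 a b i x y z hxy hyz h1 h2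
      · rw [← mul_assoc] at hw
        obtain ⟨q, rfl, rfl⟩ := exists_mul_of_d_le hw.symm (by simpa using hc')
        exact hu.no_fake a q i x y z hxy hyz (by simp only [mul_assoc])
  · intro a r b hw
    rcases le_total u.d (a * r.rev).d with hc | hc
    · rcases le_total u.d a.d with hc' | hc'
      · obtain ⟨q, rfl, rfl⟩ := exists_mul_of_d_le hw hc'
        exact hv.no_back q r b rfl
      · obtain ⟨q, rfl, hq⟩ := exists_mul_of_d_le hw.symm hc'
        rw [mul_d, mul_d, rev_d] at hc
        obtain ⟨p, hp, rfl⟩ := exists_mul_of_d_le hq.symm (by rw [rev_d]; linarith)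
        have hr : r = p.rev * q.rev := by rw [← rev_rev r, hp, rev_mul]
        have hp1 : p = 1 := by
          rw [← rev_eq_one]
          exact hv.no_back 1 p.rev (q.rev * b) (by rw [hr]; simp [mul_assoc])
        subst hp1
        rw [mul_one] at hp
        refine h.1 a r b ?_ (by rw [one_mul])
        rw [hp]
    · rw [← mul_assoc] at hw
      obtain ⟨q, rfl, hq⟩ := exists_mul_of_d_le hw.symm hc
      rcases le_total q.d r.d with hc' | hc'
      · obtain ⟨p, rfl, rfl⟩ := exists_mul_of_d_le hq.symm hc'
        have hq1 : q = 1 :=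
          hu.no_back (a * p.rev) q 1 (by simp [mul_assoc])
        subst hq1
        refine h.1 a _ b ?_ ?_
        · rw [mul_one]
        · rw [one_mul]
      · obtain ⟨p, rfl, -⟩ := exists_mul_of_d_le hq hc'
        exact hu.no_back a r p (by simp only [mul_assoc])

lemma red_letter {i : I} {x y : M i} (hxy : x ≠ y) : Red (letter x y : PathWord I M) := by
  constructor
  · intro t ht
    refine ⟨1, 1, i, x, y, hxy, by simp, ?_⟩
    simpa using (letter x y).dom_sub t ht
  · intro s t hs hst ht
    refine ⟨(s + t) / 2, ⟨by linarith, by linarith⟩, ?_⟩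
    rw [letter_f]
    · rfl
    · rw [letter_d] at ht
      constructor <;> linarith
  · intro a b j z w v hzw hwv h
    have h1 := dist_pos.2 hzw
    have h2 := dist_pos.2 hwv
    have ha := a.d_nonneg
    have hb := b.d_nonneg
    have hd := congrArg PathWord.d h
    simp only [letter_d, mul_d] at hd
    have h' : (a * letter z w) * (letter w v * b) = 1 * (letter x y * 1) := by
      rw [one_mul, mul_one, h, mul_assoc]
    rcases letter_not_cut h' with hc | hc <;> simp only [mul_d, letter_d, one_d] at hc <;> linarith
  · intro a r b h
    by_contra hr
    have hr' := d_pos_of_ne_one hr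
    have ha := a.d_nonneg
    have hb := b.d_nonneg
    have hd := congrArg PathWord.d h
    simp only [letter_d, mul_d, rev_d] at hd
    have h' : (a * r.rev) * (r * b) = 1 * (letter x y * 1) := by
      rw [one_mul, mul_one, h, mul_assoc]
    rcases letter_not_cut h' with hc | hc <;> simp only [mul_d, rev_d, one_d] at hc <;> linarith

end Red

section Tripod

/-- `k` is the reduced word representing `f⁻¹ g`. -/
def Tripod (f g k : PathWord I M) : Prop :=
  (∃ a b c, f = a * b ∧ g = a * c ∧ k = b.rev * c ∧ Junc b.rev c) ∨
  ∃ (a b c : PathWord I M) (i : I) (x y z : M i), x ≠ y ∧ x ≠ z ∧ y ≠ z ∧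
    f = a * (letter x y * b) ∧ g = a * (letter x z * c) ∧ k = b.rev * (letter y z * c)

lemma Tripod.symm {f g k : PathWord I M} (h : Tripod f g k) : Tripod g f k.rev := by
  rcases h with ⟨a, b, c, rfl, rfl, rfl, hJ⟩ | ⟨a, b, c, i, x, y, z, hxy, hxz, hyz, rfl, rfl, rfl⟩
  · refine Or.inl ⟨a, c, b, rfl, rfl, by simp, ?_⟩
    simpa using hJ.rev
  · exact Or.inr ⟨a, c, b, i, x, z, y, hxz, hxy, hyz.symm, rfl, rfl, by simp [mul_assoc]⟩

lemma Tripod.mul_left {f g k : PathWord I M} (h : Tripod f g k) (u : PathWord I M) :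
    Tripod (u * f) (u * g) k := by
  rcases h with ⟨a, b, c, rfl, rfl, rfl, hJ⟩ | ⟨a, b, c, i, x, y, z, hxy, hxz, hyz, rfl, rfl, rfl⟩
  · exact Or.inl ⟨u * a, b, c, (mul_assoc _ _ _).symm, (mul_assoc _ _ _).symm, rfl, hJ⟩
  · exact Or.inr ⟨u * a, b, c, i, x, y, z, hxy, hxz, hyz, (mul_assoc _ _ _).symm,
      (mul_assoc _ _ _).symm, rfl⟩

lemma junc_one_left (w : PathWord I M) : Junc 1 w := by
  constructor
  · intro u r v h _
    have hd := congrArg PathWord.d h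
    simp only [one_d, mul_d, rev_d] at hd
    exact eq_one_of_d (by linarith [u.d_nonneg, r.d_nonneg])
  · intro u v i x y z hxy _ h _
    have hd := congrArg PathWord.d h
    simp only [one_d, mul_d, letter_d] at hd
    linarith [u.d_nonneg, dist_pos.2 hxy]

lemma tripod_one_left (f : PathWord I M) : Tripod 1 f f :=
  Or.inl ⟨1, 1, f, by simp, by simp, by simp, by simpa using junc_one_left f⟩

lemma tripod_self (f : PathWord I M) : Tripod f f 1 :=
  Or.inl ⟨f, 1, 1, by simp, by simp, by simp, by simpa using junc_one_left 1⟩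

lemma Tripod.red {f g k : PathWord I M} (hf : Red f) (hg : Red g) (h : Tripod f g k) :
    Red k := by
  rcases h with ⟨a, b, c, rfl, rfl, rfl, hJ⟩ | ⟨a, b, c, i, x, y, z, hxy, hxz, hyz, rfl, rfl, rfl⟩
  · exact hf.right.rev.mul hg.right hJ
  · have hb := hf.right
    have hc := hg.right
    refine hb.right.rev.mul ((red_letter hyz).mul hc.right ?_) ?_
    · have h1 := hc.junc
      rw [← one_mul (letter x z), junc_mul_letter_iff hxz] at h1
      rwa [← one_mul (letter y z), junc_mul_letter_iff hyz]
    · have h1 := hb.junc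
      rw [← one_mul (letter x y), junc_mul_letter_iff hxy] at h1
      refine Junc.mul_right ?_ (letter_ne_one hyz) c
      have h2 : Junc (1 * letter z y) b := (junc_mul_letter_iff hyz.symm).2 h1
      rw [one_mul] at h2
      simpa using h2.rev

lemma Red.f_eq_none_of_isLUB {f : PathWord I M} (hf : Red f) {A : Set ℝ} {s : ℝ}
    (hs : IsLUB A s) (hA : ∀ t ∈ A, f.f t = none) : f.f s = none := by
  by_contra hsome
  obtain ⟨a, b, i, x, y, -, rfl, h1, h2⟩ :=
    hf.exists_letter s (Option.isSome_iff_ne_none.2 hsome)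
  obtain ⟨t, htA, hat, hts⟩ := hs.exists_between h1
  have := mul_letter_mul_f a b (x := x) (y := y) (t := t) ⟨hat, by linarith⟩
  rw [hA t htA] at this
  cases this

/-- Two reduced words have a longest common left factor. -/
lemma exists_maximal_left_factor {f g : PathWord I M} (hf : Red f) (hg : Red g) :
    ∃ a b c, f = a * b ∧ g = a * c ∧ ∀ r b' c', b = r * b' → c = r * c' → r = 1 := by
  set A : Set ℝ := {s | ∃ a b c : PathWord I M, f = a * b ∧ g = a * c ∧ a.d = s} with hA
  have h0 : (0 : ℝ) ∈ A := ⟨1, f, g, by simp, by simp, rfl⟩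
  have hbf : ∀ s ∈ A, s ≤ f.d := by
    rintro s ⟨a, b, c, rfl, rfl, rfl⟩
    simpa using b.d_nonneg
  have hbg : ∀ s ∈ A, s ≤ g.d := by
    rintro s ⟨a, b, c, rfl, rfl, rfl⟩
    simpa using c.d_nonneg
  have hlub : IsLUB A (sSup A) := isLUB_csSup ⟨0, h0⟩ ⟨f.d, hbf⟩
  have hfn : f.f (sSup A) = none := by
    refine hf.f_eq_none_of_isLUB hlub ?_
    rintro t ⟨a, b, c, rfl, -, rfl⟩
    exact mul_f_junction a b
  have hgn : g.f (sSup A) = none := by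
    refine hg.f_eq_none_of_isLUB hlub ?_
    rintro t ⟨a, b, c, -, rfl, rfl⟩
    exact mul_f_junction a c
  obtain ⟨a, b, c, hfa, hga, ha⟩ := exists_common_left_factor (u := f) (v := g) (s := sSup A)
    (hlub.1 h0) (hlub.2 hbf) (hlub.2 hbg) hfn (by
      rintro t ⟨ht0, hts⟩
      rcases hts.eq_or_lt with rfl | hlt
      · rw [hfn, hgn]
      · obtain ⟨s, ⟨a, b, c, rfl, rfl, rfl⟩, h1, h2⟩ := hlub.exists_between hlt
        rw [mul_f_of_le _ _ h1.le, mul_f_of_le _ _ h1.le])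
  refine ⟨a, b, c, hfa, hga, ?_⟩
  rintro r b' c' rfl rfl
  have hmem : (a * r).d ∈ A := ⟨a * r, b', c', by rw [hfa, mul_assoc], by rw [hga, mul_assoc], rfl⟩
  have := hlub.1 hmem
  rw [mul_d, ha] at this
  exact eq_one_of_d (le_antisymm (by linarith) r.d_nonneg)

lemma exists_tripod {f g : PathWord I M} (hf : Red f) (hg : Red g) : ∃ k, Tripod f g k := by
  obtain ⟨a, b, c, rfl, rfl, hmax⟩ := exists_maximal_left_factor hf hg
  by_cases hJ : Junc b.rev c
  · exact ⟨_, Or.inl ⟨a, b, c, rfl, rfl, rfl, hJ⟩⟩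
  · rw [Junc, not_and_or] at hJ
    rcases hJ with hJ | hJ
    · refine absurd ?_ hJ
      intro u' r v' h1 h2
      refine hmax r u'.rev v' ?_ h2
      rw [← rev_rev b, h1, rev_mul, rev_rev]
    · push Not at hJ
      obtain ⟨u', v', i, y, x, z, hyx, hxz, h1, rfl, -⟩ := hJ
      have hb : b = letter x y * u'.rev := by
        rw [← rev_rev b, h1, rev_mul, rev_letter]
      subst hb
      have hyz : y ≠ z := by
        rintro rfl
        exact letter_ne_one hxz (hmax _ _ _ rfl rfl)
      exact ⟨_, Or.inr ⟨a, u'.rev, v', i, x, y, z, hyx.symm, hxz, hyz, rfl, rfl, rfl⟩⟩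

lemma fork_le {a b c a' b' c' : PathWord I M} (h1 : a * b = a' * b') (h2 : a * c = a' * c')
    (hJ : Junc b.rev c) : a'.d ≤ a.d := by
  by_contra! hlt
  obtain ⟨r, rfl, rfl⟩ := exists_mul_of_d_le h1 hlt.le
  rw [mul_assoc] at h2
  obtain rfl := mul_left_cancel' h2
  have := hJ.1 b'.rev r c' (by simp) rfl
  subst this
  simp at hlt

lemma tri_lt_le {a b c a' b' c' : PathWord I M} {i : I} {x y z : M i} (hxy : x ≠ y)
    (hxz : x ≠ z) (hyz : y ≠ z) (h1 : a * (letter x y * b) = a' * b')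
    (h2 : a * (letter x z * c) = a' * c') : a'.d ≤ a.d := by
  by_contra! hlt
  obtain ⟨r, rfl, hr⟩ := exists_mul_of_d_le h1 hlt.le
  rw [mul_assoc] at h2
  have h2 := mul_left_cancel' h2
  have hr0 : 0 < r.d := by simpa using hlt
  have key : ∀ {w : M i} {p q : PathWord I M}, x ≠ w → letter x w * p = r * q →
      ∃ s, r = letter x w * s := by
    intro w p q hxw h
    have h' : r * q = 1 * (letter x w * p) := by rw [one_mul, h]
    rcases letter_not_cut h' with hc | hc
    · rw [one_d] at hc
      linarith
    · rw [one_d, zero_add] at hc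
      obtain ⟨s, hs, -⟩ := exists_mul_of_d_le h hc
      exact ⟨s, hs⟩
  obtain ⟨s, rfl⟩ := key hxy hr
  obtain ⟨s', hs'⟩ := key hxz h2
  obtain ⟨h3, -⟩ := letter_inj hxy hxz hs'
  cases h3
  exact hyz rfl

lemma fork_tri_false {a b c a' b' c' : PathWord I M} {i : I} {x y z : M i} (hxy : x ≠ y)
    (hxz : x ≠ z) (hyz : y ≠ z) (h1 : a * (letter x y * b) = a' * b')
    (h2 : a * (letter x z * c) = a' * c') (hJ : Junc b'.rev c') : False := by
  obtain ⟨rfl, rfl⟩ := mul_inj_of_d_eq h1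
    (le_antisymm (fork_le h1.symm h2.symm hJ) (tri_lt_le hxy hxz hyz h1 h2))
  obtain rfl := mul_left_cancel' h2
  exact hJ.2 b.rev c i y x z hxy.symm hxz (by simp) rfl

lemma Tripod.unique {f g k k' : PathWord I M} (h : Tripod f g k) (h' : Tripod f g k') :
    k = k' := by
  rcases h with ⟨a, b, c, rfl, rfl, rfl, hJ⟩ | ⟨a, b, c, i, x, y, z, hxy, hxz, hyz, rfl, rfl, rfl⟩
  · rcases h' with ⟨a', b', c', h1, h2, rfl, hJ'⟩ |
      ⟨a', b', c', i, x, y, z, hxy, hxz, hyz, h1, h2, rfl⟩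
    · obtain ⟨rfl, rfl⟩ := mul_inj_of_d_eq h1
        (le_antisymm (fork_le h1.symm h2.symm hJ') (fork_le h1 h2 hJ))
      rw [mul_left_cancel' h2]
    · exact (fork_tri_false hxy hxz hyz h1.symm h2.symm hJ).elim
  · rcases h' with ⟨a', b', c', h1, h2, rfl, hJ'⟩ |
      ⟨a', b', c', j, x', y', z', hxy', hxz', hyz', h1, h2, rfl⟩
    · exact (fork_tri_false hxy hxz hyz h1 h2 hJ').elim
    · obtain ⟨rfl, h3⟩ := mul_inj_of_d_eq h1
        (le_antisymm (tri_lt_le hxy' hxz' hyz' h1.symm h2.symm) (tri_lt_le hxy hxz hyz h1 h2))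
      obtain ⟨h4, rfl⟩ := letter_inj hxy hxy' h3
      obtain ⟨h5, rfl⟩ := letter_inj hxz hxz' (mul_left_cancel' h2)
      cases h4
      cases h5
      rfl

lemma cocycle_fork_fork {a b c a' b' e : PathWord I M} (hp : a * b = a' * b')
    (hd : a.d ≤ a'.d) (hJ : Junc b.rev c) (hc : Red (a * c)) (he : Red (a' * e)) :
    ∃ m, Tripod (a * c) (a' * e) m ∧ Tripod (b.rev * c) (b'.rev * e) m := by
  obtain ⟨r, rfl, rfl⟩ := exists_mul_of_d_le hp hd
  by_cases hr : r = 1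
  · subst hr
    obtain ⟨m, hm⟩ := exists_tripod hc.right he.right
    refine ⟨m, ?_, ?_⟩
    · simpa using hm.mul_left a
    · simpa using hm.mul_left b'.rev
  · refine ⟨c.rev * (r * e), Or.inl ⟨a, c, r * e, rfl, mul_assoc _ _ _, rfl, ?_⟩,
      Or.inl ⟨b'.rev, r.rev * c, e, by simp [mul_assoc], rfl, by simp [mul_assoc], ?_⟩⟩
    · have h := hJ.rev
      rw [rev_rev] at h
      exact h.of_mul_right.mul_right hr e
    · rw [rev_mul, rev_rev]
      exact he.junc.of_mul_left.mul_left hr _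

lemma cocycle_tri_tri {a b c a' b' e : PathWord I M} {i j : I} {x y z : M i} {x' y' w : M j}
    (hxy : x ≠ y) (hxz : x ≠ z) (hyz : y ≠ z) (hxy' : x' ≠ y') (hxw : x' ≠ w) (hyw : y' ≠ w)
    (hp : a * (letter x y * b) = a' * (letter x' y' * b')) (hd : a.d ≤ a'.d)
    (hc : Red (a * (letter x z * c))) (he : Red (a' * (letter x' w * e))) :
    ∃ m, Tripod (a * (letter x z * c)) (a' * (letter x' w * e)) m ∧
      Tripod (b.rev * (letter y z * c)) (b'.rev * (letter y' w * e)) m := by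
  rcases letter_not_cut hp.symm with hd' | hd'
  · obtain ⟨rfl, h1⟩ := mul_inj_of_d_eq hp (le_antisymm hd hd')
    obtain ⟨h2, rfl⟩ := letter_inj hxy hxy' h1
    cases h2
    by_cases hzw : z = w
    · subst hzw
      obtain ⟨m, hm⟩ := exists_tripod hc.right.right he.right.right
      refine ⟨m, ?_, ?_⟩
      · simpa [mul_assoc] using hm.mul_left (a * letter x z)
      · simpa [mul_assoc] using hm.mul_left (b.rev * letter y z)
    · exact ⟨_, Or.inr ⟨a, c, e, i, x, z, w, hxz, hxw, hzw, rfl, rfl, rfl⟩,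
        Or.inr ⟨b.rev, c, e, i, y, z, w, hyz, hyw, hzw, rfl, rfl, rfl⟩⟩
  · rw [← mul_assoc] at hp
    obtain ⟨r, rfl, rfl⟩ := exists_mul_of_d_le hp (by simpa using hd')
    refine ⟨c.rev * (letter z y * (r * (letter x' w * e))),
      Or.inr ⟨a, c, r * (letter x' w * e), i, x, z, y, hxz, hxy, hyz.symm, rfl,
        by simp only [mul_assoc], rfl⟩,
      Or.inr ⟨b'.rev, r.rev * (letter y z * c), e, j, y', x', w, hxy'.symm, hyw, hxw,
        by simp [mul_assoc], rfl, by simp [mul_assoc]⟩⟩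

lemma cocycle_tri_fork {a b c a' b' e : PathWord I M} {i : I} {x y z : M i}
    (hxy : x ≠ y) (hxz : x ≠ z) (hyz : y ≠ z) (hJ : Junc b'.rev e)
    (hp : a * (letter x y * b) = a' * b') (he : Red (a' * e)) :
    ∃ m, Tripod (a * (letter x z * c)) (a' * e) m ∧
      Tripod (b.rev * (letter y z * c)) (b'.rev * e) m := by
  rcases letter_not_cut hp.symm with hd | hd
  · obtain ⟨r, rfl, rfl⟩ := exists_mul_of_d_le hp.symm hd
    refine ⟨c.rev * (letter z x * (r.rev * e)),
      Or.inl ⟨a', r * (letter x z * c), e, by simp only [mul_assoc], rfl, by simp [mul_assoc], ?_⟩,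
      Or.inr ⟨b.rev, c, r.rev * e, i, y, z, x, hyz, hxy.symm, hxz.symm, rfl,
        by simp [mul_assoc], rfl⟩⟩
    have h : Junc (b.rev * (letter y x * r.rev)) e := by simpa [mul_assoc] using hJ
    have h' := h.replace_letter (u' := c.rev) hxy.symm hxz.symm
    simpa [mul_assoc] using h'
  · rw [← mul_assoc] at hp
    obtain ⟨r, rfl, rfl⟩ := exists_mul_of_d_le hp (by simpa using hd)
    refine ⟨c.rev * (letter z y * (r * e)),
      Or.inr ⟨a, c, r * e, i, x, z, y, hxz, hxy, hyz.symm, rfl, by simp only [mul_assoc], rfl⟩,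
      Or.inl ⟨b'.rev, r.rev * (letter y z * c), e, by simp [mul_assoc], rfl,
        by simp [mul_assoc], ?_⟩⟩
    have h : Junc (a * (letter x y * r)) e := by simpa [mul_assoc] using he.junc
    have h' := h.replace_letter (u' := c.rev) hxy hyz.symm
    simpa [mul_assoc] using h'

/-- The cocycle identity `(f⁻¹ g)⁻¹ (f⁻¹ h) = g⁻¹ h`. -/
lemma Tripod.cocycle {f g h k l : PathWord I M} (hg : Red g) (hh : Red h)
    (h1 : Tripod f g k) (h2 : Tripod f h l) : ∃ m, Tripod g h m ∧ Tripod k l m := by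
  have swap : (∃ m, Tripod h g m ∧ Tripod l k m) → ∃ m, Tripod g h m ∧ Tripod k l m :=
    fun ⟨m, hm, hm'⟩ => ⟨m.rev, hm.symm, hm'.symm⟩
  rcases h1 with ⟨a, b, c, rfl, rfl, rfl, hJ⟩ |
    ⟨a, b, c, i, x, y, z, hxy, hxz, hyz, rfl, rfl, rfl⟩
  · rcases h2 with ⟨a', b', e, hp, rfl, rfl, hJ'⟩ |
      ⟨a', b', e, j, x', y', w, hxy', hxw, hyw, hp, rfl, rfl⟩
    · rcases le_total a.d a'.d with hd | hd
      · exact cocycle_fork_fork hp hd hJ hg hh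
      · exact swap (cocycle_fork_fork hp.symm hd hJ' hh hg)
    · exact swap (cocycle_tri_fork hxy' hxw hyw hJ hp.symm hg)
  · rcases h2 with ⟨a', b', e, hp, rfl, rfl, hJ'⟩ |
      ⟨a', b', e, j, x', y', w, hxy', hxw, hyw, hp, rfl, rfl⟩
    · exact cocycle_tri_fork hxy hxz hyz hJ' hp hh
    · rcases le_total a.d a'.d with hd | hd
      · exact cocycle_tri_tri hxy hxz hyz hxy' hxw hyw hp hd hg hh
      · exact swap (cocycle_tri_tri hxy' hxw hyw hxy hxz hyz hp.symm hd hh hg)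

end Tripod

section CommonLeftFactor

lemma Red.exists_first_letter {w : PathWord I M} (h : Red w) {q : ℝ} (hq : 0 < q)
    (hw : ∀ t ∈ Set.Ioo 0 q, (w.f t).isSome) :
    ∃ (b : PathWord I M) (i : I) (x y : M i), x ≠ y ∧ w = letter x y * b := by
  obtain ⟨a, b, i, x, y, hxy, rfl, h1, -⟩ :=
    h.exists_letter (q / 2) (hw _ ⟨by linarith, by linarith⟩)
  have ha : a = 1 := by
    by_contra hne
    have := hw a.d ⟨d_pos_of_ne_one hne, by linarith⟩
    rw [mul_f_junction] at this
    simp at this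
  exact ⟨b, i, x, y, hxy, by rw [ha, one_mul]⟩

lemma Red.f_eq_none_of_agree {u v : PathWord I M} (hu : Red u) (hv : Red v) {q : ℝ}
    (hqu : q ≤ u.d) (h : ∀ t ∈ Set.Ioo 0 q, (u.f t).isSome → u.f t = v.f t) {t : ℝ}
    (ht : t ∈ Set.Ioo 0 q) (hut : u.f t = none) : v.f t = none := by
  by_contra hvt
  obtain ⟨a, b, i, x, y, hxy, rfl, h1, h2⟩ :=
    hv.exists_letter t (Option.isSome_iff_ne_none.2 hvt)
  have ha := a.d_nonneg
  obtain ⟨s, ⟨hs1, hs2⟩, hs⟩ := hu.dense a.d t ha h1 (ht.2.le.trans hqu)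
  have hus := h s ⟨by linarith, hs2.trans ht.2⟩ hs
  rw [mul_letter_mul_f a b (x := x) (y := y) ⟨hs1, by linarith⟩] at hus
  obtain ⟨a', b', j, z, w, hzw, rfl, h3, h4⟩ := hu.exists_letter s hs
  have ha' := a'.d_nonneg
  rw [mul_letter_mul_f a' b' ⟨h3, h4⟩] at hus
  cases hus
  have h5 : a'.d + dist x y ≤ t := by
    by_contra! hc
    rw [mul_letter_mul_f a' b' ⟨by linarith, hc⟩] at hut
    cases hut
  have h6 : a.d ≤ a'.d := by
    by_contra! hc
    have h7 := mul_letter_mul_f a' b' (x := x) (y := y) (t := a.d) ⟨hc, by linarith⟩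
    have h8 := h a.d ⟨by linarith, by linarith [ht.2]⟩ (by rw [h7]; rfl)
    rw [h7, mul_f_junction] at h8
    cases h8
  linarith

/-- Reduced words which agree near `0` on the domain of the first one have a nontrivial common
left factor. -/
lemma Red.exists_common_left_factor {u v : PathWord I M} (hu : Red u) (hv : Red v) {q : ℝ}
    (hq : 0 < q) (hqu : q ≤ u.d) (hqv : q ≤ v.d)
    (h : ∀ t ∈ Set.Ioo 0 q, (u.f t).isSome → u.f t = v.f t) :
    ∃ r u' v', r ≠ 1 ∧ u = r * u' ∧ v = r * v' := by
  have heq : ∀ t ∈ Set.Ioo 0 q, u.f t = v.f t := by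
    intro t ht
    by_cases hut : (u.f t).isSome
    · exact h t ht hut
    · rw [Option.not_isSome_iff_eq_none] at hut
      rw [hut, hu.f_eq_none_of_agree hv hqu h ht hut]
  by_cases hdom : ∀ t ∈ Set.Ioo 0 q, (u.f t).isSome
  · obtain ⟨b, i, x, y, hxy, rfl⟩ := hu.exists_first_letter hq hdom
    obtain ⟨c, j, z, w, hzw, rfl⟩ :=
      hv.exists_first_letter hq (fun t ht => by rw [← heq t ht]; exact hdom t ht)
    have h1 := dist_pos.2 hxy
    have h2 := dist_pos.2 hzw
    set m := min q (min (dist x y) (dist z w)) with hm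
    have hm0 : 0 < m := lt_min hq (lt_min h1 h2)
    have hm1 : m ≤ q := min_le_left _ _
    have hm2 : m ≤ dist x y := (min_le_right _ _).trans (min_le_left _ _)
    have hm3 : m ≤ dist z w := (min_le_right _ _).trans (min_le_right _ _)
    have h3 := heq (m / 2) ⟨by linarith, by linarith⟩
    rw [mul_f_of_le _ _ (by rw [letter_d]; linarith),
      mul_f_of_le _ _ (by rw [letter_d]; linarith), letter_f ⟨by linarith, by linarith⟩,
      letter_f ⟨by linarith, by linarith⟩] at h3
    cases h3
    exact ⟨letter x y, b, c, letter_ne_one hxy, rfl, rfl⟩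
  · push Not at hdom
    obtain ⟨t, ht, hut⟩ := hdom
    obtain ⟨r, u', v', hu', hv', hr⟩ :=
      PathWord.exists_common_left_factor (u := u) (v := v) ht.1.le (ht.2.le.trans hqu)
        (ht.2.le.trans hqv) (by simpa using hut)
        (fun s hs => heq s ⟨hs.1, hs.2.trans_lt ht.2⟩)
    refine ⟨r, u', v', ?_, hu', hv'⟩
    rintro rfl
    exact absurd ht.1 (by rw [← hr, one_d]; exact lt_irrefl 0)

end CommonLeftFactor

section ToTreeProdFun

lemma Red.exists_letter_of_interval {w : PathWord I M} (h : Red w) {p q : ℝ}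
    (hdom : ∀ t ∈ Set.Ioo p q, (w.f t).isSome) (hp : ¬ (w.f p).isSome) (hq : ¬ (w.f q).isSome)
    {t : ℝ} (ht : t ∈ Set.Ioo p q) {i : I} {x y : M i} (hv : w.f t = some ⟨i, (x, y)⟩) :
    x ≠ y ∧ ∃ a b, w = a * (letter x y * b) ∧ a.d = p ∧ a.d + dist x y = q := by
  obtain ⟨a, b, j, z, z', hz, rfl, h1, h2⟩ := h.exists_letter t (hdom t ht)
  rw [mul_letter_mul_f a b ⟨h1, h2⟩] at hv
  cases hv
  refine ⟨hz, a, b, rfl, ?_, ?_⟩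
  · rcases lt_trichotomy a.d p with hc | hc | hc
    · rw [mul_letter_mul_f a b ⟨hc, by linarith [ht.1]⟩] at hp
      exact absurd rfl hp
    · exact hc
    · have := hdom a.d ⟨hc, by linarith [ht.2]⟩
      rw [mul_f_junction] at this
      simp at this
  · rcases lt_trichotomy (a.d + dist x y) q with hc | hc | hc
    · have := hdom _ ⟨by linarith [ht.1], hc⟩
      rw [← mul_assoc, show a.d + dist x y = (a * letter x y).d from rfl,
        mul_f_junction] at this
      simp at this
    · exact hc
    · rw [mul_letter_mul_f a b ⟨by linarith [ht.2], hc⟩] at hq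
      exact absurd rfl hq

lemma Red.eventually_eq {w : PathWord I M} (h : Red w) {t : ℝ} (ht : (w.f t).isSome) :
    ∀ᶠ s in nhds t, w.f s = w.f t := by
  obtain ⟨a, b, i, x, y, -, rfl, hmem⟩ := h.exists_letter t ht
  filter_upwards [Ioo_mem_nhds hmem.1 hmem.2] with s hs
  rw [mul_letter_mul_f a b hs, mul_letter_mul_f a b hmem]

lemma Red.distinct {w : PathWord I M} (h : Red w) {t : ℝ} {i : I} {x y : M i}
    (hv : w.f t = some ⟨i, (x, y)⟩) : x ≠ y := by
  obtain ⟨a, b, j, z, z', hz, rfl, hmem⟩ := h.exists_letter t (by rw [hv]; rfl)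
  rw [mul_letter_mul_f a b hmem] at hv
  cases hv
  exact hz

lemma Red.not_backtrack {w : PathWord I M} (h : Red w) {p q : ℝ} (hq : 0 < q)
    (hsub : Set.Ioo (p - q) (p + q) ⊆ Set.Ioo 0 w.d) :
    ¬ ∀ t ∈ Set.Ioo (p - q) (p + q), w.f t = (w.f (2 * p - t)).map swapVal := by
  intro H
  have hp : p ∈ Set.Ioo 0 w.d := hsub ⟨by linarith, by linarith⟩
  have hpn : w.f p = none := by
    by_contra hne
    obtain ⟨⟨i, x, y⟩, hv⟩ := Option.ne_none_iff_exists'.1 hne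
    have h1 := H p ⟨by linarith, by linarith⟩
    rw [show 2 * p - p = p by ring, hv] at h1
    have h2 : x = y := by
      simp only [Option.map_some, swapVal, Option.some.injEq, Sigma.mk.injEq, heq_eq_eq,
        Prod.mk.injEq, true_and] at h1
      exact h1.1
    exact h.distinct hv h2
  have hq1 : q ≤ p := by
    by_contra! hc
    have h0 : (0 : ℝ) ∈ Set.Ioo 0 w.d := hsub ⟨by linarith, by linarith [hp.1]⟩
    exact lt_irrefl 0 h0.1
  have hq2 : p + q ≤ w.d := by
    by_contra! hc
    have h0 : w.d ∈ Set.Ioo 0 w.d := hsub ⟨by linarith [hp.2], hc⟩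
    exact lt_irrefl _ h0.2
  obtain ⟨u, v, rfl, hu⟩ := exists_cut w hp.1.le hp.2.le hpn
  rw [mul_d] at hq2
  obtain ⟨r, v', u', hr, hv', hu'⟩ := h.right.exists_common_left_factor h.left.rev hq
    (by linarith) (by rw [rev_d]; linarith) (by
      intro t ht _
      have h1 := H (u.d + t) ⟨by linarith [ht.1], by linarith [ht.2]⟩
      rw [mul_f_add u v ht.1.le, mul_f_of_le u v (by linarith [ht.1])] at h1
      rw [h1, rev_f]
      congr 2
      linarith)
  refine hr (h.no_back u'.rev r v' ?_)
  rw [← rev_rev u, hu', hv', rev_mul, mul_assoc]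

/-- A reduced word as an element of the tree product. -/
def Red.toTreeProdFun {w : PathWord I M} (h : Red w) : TreeProdFun I M where
  d := w.d
  d_nonneg := w.d_nonneg
  f := w.f
  dom_sub := w.dom_sub
  dom_open := by
    rw [isOpen_iff_mem_nhds]
    intro t ht
    filter_upwards [h.eventually_eq ht] with s hs
    rw [hs]
    exact ht
  dom_dense := by
    intro t ht
    rw [Metric.mem_closure_iff]
    intro ε hε
    have h1 := ht.2
    obtain ⟨r, hr, hr'⟩ := h.dense t (min w.d (t + ε)) ht.1.le
      (lt_min h1 (by linarith)) (min_le_left _ _)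
    refine ⟨r, hr', ?_⟩
    have h2 := hr.2.trans_le (min_le_right _ _)
    rw [dist_comm, Real.dist_eq, abs_of_pos (by linarith [hr.1])]
    linarith
  distinct := fun t i x y hv => h.distinct hv
  locConst := fun t ht => h.eventually_eq ht
  intervalLen := by
    intro p q _ hdom hp hq t ht i x y hv
    obtain ⟨-, a, b, -, h1, h2⟩ := h.exists_letter_of_interval hdom hp hq ht hv
    linarith
  noFakeExit := by
    rintro p q r _ _ hdom hdom' hp hq hr s hs t ht i x y z z' hv hv' rfl
    obtain ⟨hxy, a, b, rfl, h1, h2⟩ := h.exists_letter_of_interval hdom hp hq hs hv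
    obtain ⟨hyz, a', b', hw, h3, h4⟩ := h.exists_letter_of_interval hdom' hq hr ht hv'
    rw [← mul_assoc] at hw
    obtain ⟨-, rfl⟩ := mul_inj_of_d_eq hw (by rw [mul_d, letter_d, h2, h3])
    exact h.no_fake a b' i x y z' hxy hyz rfl
  noBacktrack := fun p q hq hsub => h.not_backtrack hq hsub

end ToTreeProdFun

end PathWord

namespace TreeProdFun

open PathWord

/-- The underlying word of an element of the tree product. -/
def toWord (f : TreeProdFun I M) : PathWord I M := ⟨f.d, f.d_nonneg, f.f, f.dom_sub⟩

lemma toWord_injective : Function.Injective (toWord : TreeProdFun I M → PathWord I M) := by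
  intro f g h
  have hd : f.d = g.d := congrArg PathWord.d h
  have hf : f.f = g.f := congrArg PathWord.f h
  cases f
  cases g
  cases hd
  cases hf
  rfl

lemma exists_right_end {α : Type*} {F : ℝ → Option α}
    (hF : ∀ t, (F t).isSome → ∀ᶠ s in nhds t, F s = F t) {t d : ℝ} {v : α}
    (ht : F t = some v) (htd : t ≤ d) (hd : F d = none) :
    ∃ q, t < q ∧ q ≤ d ∧ F q = none ∧ ∀ s ∈ Set.Ico t q, F s = some v := by
  set S : Set ℝ := {s | t ≤ s ∧ F s ≠ some v} with hS
  have hdS : d ∈ S := ⟨htd, by rw [hd]; exact nofun⟩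
  have hbdd : BddBelow S := ⟨t, fun s hs => hs.1⟩
  have htq : t ≤ sInf S := le_csInf ⟨d, hdS⟩ fun s hs => hs.1
  have hval : ∀ s ∈ Set.Ico t (sInf S), F s = some v := by
    intro s hs
    by_contra hne
    exact absurd (csInf_le hbdd (show s ∈ S from ⟨hs.1, hne⟩)) (not_le.2 hs.2)
  have hq : F (sInf S) ≠ some v := by
    intro hc
    have hev := hF (sInf S) (by rw [hc]; rfl)
    obtain ⟨ε, hε, hball⟩ := Metric.eventually_nhds_iff.1 hev
    obtain ⟨s, hsS, hs⟩ := exists_lt_of_csInf_lt ⟨d, hdS⟩ (lt_add_of_pos_right (sInf S) hε)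
    have h1 := csInf_le hbdd hsS
    refine hsS.2 ((hball ?_).trans hc)
    rw [Real.dist_eq, abs_of_nonneg (by linarith)]
    linarith
  have hlt : t < sInf S := by
    refine lt_of_le_of_ne htq fun heq => hq ?_
    rw [← heq, ht]
  refine ⟨sInf S, hlt, csInf_le hbdd hdS, ?_, hval⟩
  by_contra hne
  have hev := hF (sInf S) (Option.isSome_iff_ne_none.2 hne)
  obtain ⟨ε, hε, hball⟩ := Metric.eventually_nhds_iff.1 hev
  have hm1 := le_max_left t (sInf S - ε / 2)
  have hm2 := le_max_right t (sInf S - ε / 2)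
  have hm3 : max t (sInf S - ε / 2) < sInf S := max_lt hlt (by linarith)
  refine hq ((hball (y := max t (sInf S - ε / 2)) ?_).symm.trans (hval _ ⟨hm1, hm3⟩))
  rw [Real.dist_eq, abs_of_nonpos (by linarith)]
  linarith

lemma exists_left_end {α : Type*} {F : ℝ → Option α}
    (hF : ∀ t, (F t).isSome → ∀ᶠ s in nhds t, F s = F t) {t d : ℝ} {v : α}
    (ht : F t = some v) (htd : d ≤ t) (hd : F d = none) :
    ∃ p, p < t ∧ d ≤ p ∧ F p = none ∧ ∀ s ∈ Set.Ioc p t, F s = some v := by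
  obtain ⟨q, h1, h2, h3, h4⟩ := exists_right_end (F := fun s => F (-s)) (t := -t) (d := -d)
    (v := v) (fun s hs => by
      have := hF (-s) hs
      exact (continuous_neg.tendsto s).eventually this)
    (by simpa using ht) (by linarith) (by simpa using hd)
  refine ⟨-q, by linarith, by linarith, h3, fun s hs => ?_⟩
  have := h4 (-s) ⟨by linarith [hs.2], by linarith [hs.1]⟩
  simpa using this

lemma red_toWord (f : TreeProdFun I M) : Red f.toWord := by
  constructor
  · intro t ht
    have htd := f.dom_sub t ht
    obtain ⟨⟨i, x, y⟩, hv⟩ := Option.isSome_iff_exists.1 ht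
    obtain ⟨p, hpt, hp0, hp, hpv⟩ := exists_left_end f.locConst hv htd.1.le
      (f.toWord.f_eq_none_of_le_zero le_rfl)
    obtain ⟨q, htq, hqd, hq, hqv⟩ := exists_right_end f.locConst hv htd.2.le
      (f.toWord.f_eq_none_of_ge le_rfl)
    have hval : ∀ s ∈ Set.Ioo p q, f.f s = some ⟨i, (x, y)⟩ := by
      intro s hs
      rcases le_total s t with hst | hst
      · exact hpv s ⟨hs.1, hst⟩
      · exact hqv s ⟨hst, hs.2⟩
    have hlen : dist x y = q - p :=
      f.intervalLen p q (hpt.trans htq) (fun s hs => by rw [hval s hs]; rfl)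
        (by rw [hp]; exact nofun) (by rw [hq]; exact nofun) t ⟨hpt, htq⟩ i x y hv
    obtain ⟨a, b, hab, ha⟩ := exists_cut f.toWord (s := p) hp0 (hpt.le.trans htd.2.le) hp
    have hD : f.d = a.d + b.d := congrArg PathWord.d hab
    have hb : ∀ s, 0 ≤ s → b.f s = f.f (p + s) := by
      intro s hs
      rw [← mul_f_add a b hs, ← hab, ha]
      rfl
    obtain ⟨m, c, rfl, hm⟩ := exists_cut b (s := q - p) (by linarith) (by linarith)
      (by rw [hb _ (by linarith), add_sub_cancel, hq])
    have hml : m = letter x y := by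
      ext1
      · rw [hm, letter_d, hlen]
      · funext s
        by_cases hs : s ∈ Set.Ioo 0 (dist x y)
        · rw [letter_f hs, ← mul_f_of_le m c (by linarith [hs.2]), hb s hs.1.le]
          exact hval _ ⟨by linarith [hs.1], by linarith [hs.2]⟩
        · rw [Set.mem_Ioo, not_and_or, not_lt, not_lt] at hs
          rcases hs with hs | hs
          · rw [f_eq_none_of_le_zero _ hs, f_eq_none_of_le_zero _ hs]
          · rw [f_eq_none_of_ge _ (by linarith), f_eq_none_of_ge _ hs]
    refine ⟨a, c, i, x, y, f.distinct t i x y hv, by rw [hab, hml], ?_⟩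
    constructor <;> linarith
  · intro s t hs hst ht
    have hmid : (s + t) / 2 ∈ Set.Ioo 0 f.d :=
      ⟨by linarith, by linarith [show t ≤ f.d from ht]⟩
    obtain ⟨r, hr, hr'⟩ := mem_closure_iff.1 (f.dom_dense hmid) (Set.Ioo s t) isOpen_Ioo
      ⟨by linarith, by linarith⟩
    exact ⟨r, hr, hr'⟩
  · intro a b i x y z hxy hyz hw
    have h1 := dist_pos.2 hxy
    have h2 := dist_pos.2 hyz
    have hF : ∀ t, f.f t = (a * (letter x y * (letter y z * b))).f t := fun t => by
      rw [← hw]; rfl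
    have v1 : ∀ t ∈ Set.Ioo a.d (a.d + dist x y), f.f t = some ⟨i, (x, y)⟩ := fun t ht => by
      rw [hF, mul_letter_mul_f a _ ht]
    have v2 : ∀ t ∈ Set.Ioo (a.d + dist x y) (a.d + dist x y + dist y z),
        f.f t = some ⟨i, (y, z)⟩ := fun t ht => by
      rw [hF, ← mul_assoc, mul_letter_mul_f (a * letter x y) b ht]
    have n1 : f.f a.d = none := by rw [hF, mul_f_junction]
    have n2 : f.f (a.d + dist x y) = none := by
      rw [hF, ← mul_assoc]
      exact mul_f_junction (a * letter x y) _
    have n3 : f.f (a.d + dist x y + dist y z) = none := by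
      rw [hF, ← mul_assoc, ← mul_assoc]
      exact mul_f_junction (a * letter x y * letter y z) _
    refine f.noFakeExit a.d (a.d + dist x y) (a.d + dist x y + dist y z) (by linarith)
      (by linarith) (fun t ht => by rw [v1 t ht]; rfl) (fun t ht => by rw [v2 t ht]; rfl)
      (by rw [n1]; exact nofun) (by rw [n2]; exact nofun) (by rw [n3]; exact nofun)
      (a.d + dist x y / 2) ⟨by linarith, by linarith⟩
      (a.d + dist x y + dist y z / 2) ⟨by linarith, by linarith⟩ i x y y z
      (v1 _ ⟨by linarith, by linarith⟩) (v2 _ ⟨by linarith, by linarith⟩) rfl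
  · intro a r b hw
    by_contra hr
    have hr0 := d_pos_of_ne_one hr
    have ha := a.d_nonneg
    have hb := b.d_nonneg
    have hF : ∀ t, f.f t = (a * (r.rev * (r * b))).f t := fun t => by
      rw [← hw]; rfl
    have hd : f.d = a.d + (r.d + (r.d + b.d)) := congrArg PathWord.d hw
    have hleft : ∀ s ∈ Set.Icc 0 r.d, f.f (a.d + r.d - s) = (r.f s).map swapVal := by
      intro s hs
      rw [hF, mul_f_of_ge _ _ (by linarith [hs.2]),
        mul_f_of_le _ _ (by rw [rev_d]; linarith [hs.1]), rev_f]
      congr 2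
      ring
    have hright : ∀ s ∈ Set.Icc 0 r.d, f.f (a.d + r.d + s) = r.f s := by
      intro s hs
      rw [hF, ← mul_assoc, show a.d + r.d = (a * r.rev).d from rfl, mul_f_add _ _ hs.1,
        mul_f_of_le _ _ hs.2]
    refine f.noBacktrack (a.d + r.d) r.d hr0 ?_ ?_
    · intro t ht
      constructor <;> linarith [ht.1, ht.2]
    · intro t ht
      change f.f t = (f.f (2 * (a.d + r.d) - t)).map swapVal
      rcases le_total t (a.d + r.d) with htp | htp
      · have e1 := hleft (a.d + r.d - t) ⟨by linarith, by linarith [ht.1]⟩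
        have e2 := hright (a.d + r.d - t) ⟨by linarith, by linarith [ht.1]⟩
        rw [sub_sub_cancel] at e1
        rw [e1, ← e2]
        congr 2
        ring
      · have e1 := hleft (t - (a.d + r.d)) ⟨by linarith, by linarith [ht.2]⟩
        have e2 := hright (t - (a.d + r.d)) ⟨by linarith, by linarith [ht.2]⟩
        rw [add_sub_cancel] at e2
        rw [show 2 * (a.d + r.d) - t = a.d + r.d - (t - (a.d + r.d)) by ring, e1, e2,
          Option.map_map]
        exact Option.map_id'.symm

lemma divPt_eq {f g : TreeProdFun I M} {a b c : PathWord I M} (hf : f.toWord = a * b)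
    (hg : g.toWord = a * c) (hmax : ∀ r b' c', b = r * b' → c = r * c' → r = 1) :
    divPt f g = a.d := by
  have hF : ∀ t, f.f t = (a * b).f t := fun t => by rw [← hf]; rfl
  have hG : ∀ t, g.f t = (a * c).f t := fun t => by rw [← hg]; rfl
  have hfd : f.d = a.d + b.d := congrArg PathWord.d hf
  have hgd : g.d = a.d + c.d := congrArg PathWord.d hg
  have hb := b.d_nonneg
  have hc := c.d_nonneg
  refine IsGreatest.csSup_eq ⟨⟨a.d_nonneg, le_min (by linarith) (by linarith), ?_⟩, ?_⟩
  · intro t ht _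
    rw [hF, hG, mul_f_of_le _ _ ht.2.le, mul_f_of_le _ _ ht.2.le]
  · rintro s ⟨hs0, hs, heq⟩
    by_contra! hlt
    have hs1 := hs.trans (min_le_left _ _)
    have hs2 := hs.trans (min_le_right _ _)
    have hrf := f.red_toWord
    have hrg := g.red_toWord
    rw [hf] at hrf
    rw [hg] at hrg
    obtain ⟨r, b', c', hr, hb', hc'⟩ := hrf.right.exists_common_left_factor hrg.right
      (q := s - a.d) (by linarith) (by linarith) (by linarith) (by
        intro t ht hsome
        rw [← mul_f_add a b ht.1.le, ← hF] at hsome ⊢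
        rw [← mul_f_add a c ht.1.le, ← hG]
        exact heq _ ⟨by linarith [ht.1, a.d_nonneg], by linarith [ht.2]⟩ hsome)
    exact hr (hmax r b' c' hb' hc')

lemma afterPt_eq {f : TreeProdFun I M} {a b : PathWord I M} {i : I} {x y : M i} (hxy : x ≠ y)
    (hf : f.toWord = a * (letter x y * b)) : afterPt f a.d = a.d + dist x y := by
  have hF : ∀ t, f.f t = (a * (letter x y * b)).f t := fun t => by rw [← hf]; rfl
  have hfd : f.d = a.d + (dist x y + b.d) := congrArg PathWord.d hf
  have hb := b.d_nonneg
  have h0 := dist_pos.2 hxy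
  refine IsGreatest.csSup_eq
    ⟨⟨by linarith, le_max_of_le_right (by linarith), fun t ht => ?_⟩, ?_⟩
  · rw [hF, mul_letter_mul_f a b ht]
    rfl
  · rintro s ⟨-, -, hdom⟩
    by_contra! hlt
    have h1 := hdom (a.d + dist x y) ⟨by linarith, hlt⟩
    rw [hF, ← mul_assoc, show a.d + dist x y = (a * letter x y).d from rfl,
      mul_f_junction] at h1
    simp at h1

lemma exists_letter_of_lt_afterPt {f : TreeProdFun I M} {a b : PathWord I M}
    (hf : f.toWord = a * b) (h : a.d < afterPt f a.d) :
    ∃ (b' : PathWord I M) (i : I) (x y : M i), x ≠ y ∧ b = letter x y * b' := by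
  have hF : ∀ t, f.f t = (a * b).f t := fun t => by rw [← hf]; rfl
  obtain ⟨s, ⟨-, -, hdom⟩, hs⟩ := exists_lt_of_lt_csSup
    (by exact ⟨a.d, le_rfl, le_max_left _ _, fun t ht => absurd (ht.1.trans ht.2) (lt_irrefl _)⟩) h
  have hrf := f.red_toWord
  rw [hf] at hrf
  refine hrf.right.exists_first_letter (q := s - a.d) (by linarith) fun t ht => ?_
  rw [← mul_f_add a b ht.1.le, ← hF]
  exact hdom _ ⟨by linarith [ht.1], by linarith [ht.2]⟩

lemma f_midpoint {f : TreeProdFun I M} {a b : PathWord I M} {i : I} {x y : M i} (hxy : x ≠ y)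
    (hf : f.toWord = a * (letter x y * b)) :
    f.f ((a.d + afterPt f a.d) / 2) = some ⟨i, (x, y)⟩ := by
  have h0 := dist_pos.2 hxy
  rw [afterPt_eq hxy hf, show f.f = f.toWord.f from rfl, hf, mul_letter_mul_f a b]
  constructor <;> linarith

/-- `D(f, g)` is the length of the reduced word representing `f⁻¹ g`. -/
lemma Dtp_eq {f g : TreeProdFun I M} {k : PathWord I M} (h : Tripod f.toWord g.toWord k) :
    Dtp f g = k.d := by
  rcases h with ⟨a, b, c, hf, hg, rfl, hJ⟩ | ⟨a, b, c, i, x, y, z, hxy, hxz, hyz, hf, hg, rfl⟩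
  · have hdiv : divPt f g = a.d := divPt_eq hf hg fun r b' c' hb hc =>
      hJ.1 b'.rev r c' (by rw [hb, rev_mul]) hc
    have hfd : f.d = a.d + b.d := congrArg PathWord.d hf
    have hgd : g.d = a.d + c.d := congrArg PathWord.d hg
    rw [Dtp, hdiv, if_neg, mul_d, rev_d]
    · linarith
    · rintro ⟨h1, h2, h3⟩
      obtain ⟨b', i, x, y, hxy, rfl⟩ := exists_letter_of_lt_afterPt hf h1
      obtain ⟨c', j, z, w, hzw, rfl⟩ := exists_letter_of_lt_afterPt hg h2
      rw [f_midpoint hxy hf, f_midpoint hzw hg] at h3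
      obtain ⟨rfl, rfl⟩ := h3
      exact hJ.2 b'.rev c' i y x w hxy.symm hzw (by simp) rfl
  · have hdiv : divPt f g = a.d := divPt_eq hf hg fun r b' c' hb hc => by
      have h1 := tri_lt_le (a := 1) (a' := r) hxy hxz hyz (by rw [one_mul, hb])
        (by rw [one_mul, hc])
      exact eq_one_of_d (le_antisymm h1 r.d_nonneg)
    have hfd : f.d = a.d + (dist x y + b.d) := congrArg PathWord.d hf
    have hgd : g.d = a.d + (dist x z + c.d) := congrArg PathWord.d hg
    have h1 := dist_pos.2 hxy
    have h2 := dist_pos.2 hxz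
    have hopt : optSndDist (some (⟨i, (x, y)⟩ : PairVal I M)) (some ⟨i, (x, z)⟩) = dist y z := by
      simp [optSndDist]
    rw [Dtp, hdiv, f_midpoint hxy hf, f_midpoint hxz hg, if_pos, hopt, afterPt_eq hxy hf,
      afterPt_eq hxz hg]
    · simp only [mul_d, rev_d, letter_d]
      linarith
    · rw [afterPt_eq hxy hf, afterPt_eq hxz hg]
      exact ⟨by linarith, by linarith, rfl, rfl⟩

lemma exists_relative (f g : TreeProdFun I M) :
    ∃ k : TreeProdFun I M, Tripod f.toWord g.toWord k.toWord := by
  obtain ⟨k, hk⟩ := exists_tripod f.red_toWord g.red_toWord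
  exact ⟨(hk.red f.red_toWord g.red_toWord).toTreeProdFun, hk⟩

/-- The element `f⁻¹ g` of the tree product, describing the point `g` as seen from `f`. -/
noncomputable def relative (f g : TreeProdFun I M) : TreeProdFun I M :=
  (exists_relative f g).choose

lemma tripod_relative (f g : TreeProdFun I M) :
    Tripod f.toWord g.toWord (relative f g).toWord :=
  (exists_relative f g).choose_spec

lemma relative_eq {f g k : TreeProdFun I M} (h : Tripod f.toWord g.toWord k.toWord) :
    relative f g = k :=
  toWord_injective ((tripod_relative f g).unique h)

lemma relative_relative (f g h : TreeProdFun I M) :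
    relative (relative f g) (relative f h) = relative g h := by
  obtain ⟨m, hm, hm'⟩ := (tripod_relative f g).cocycle g.red_toWord h.red_toWord
    (tripod_relative f h)
  obtain rfl := hm.unique (tripod_relative g h)
  exact relative_eq hm'

lemma relative_self (f : TreeProdFun I M) : relative f f = emptyTPF I M :=
  relative_eq (tripod_self f.toWord)

lemma relative_empty_left (f : TreeProdFun I M) : relative (emptyTPF I M) f = f :=
  relative_eq (tripod_one_left f.toWord)

lemma relative_inv_inv (f : TreeProdFun I M) :
    relative (relative f (emptyTPF I M)) (emptyTPF I M) = f := by
  rw [← relative_self f, relative_relative, relative_self, relative_empty_left]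

lemma relative_inv_relative (f g : TreeProdFun I M) :
    relative (relative f (emptyTPF I M)) (relative f g) = g := by
  rw [relative_relative, relative_empty_left]

/-- Left translation by `f⁻¹`. -/
noncomputable def relativeEquiv (f : TreeProdFun I M) : TreeProdFun I M ≃ TreeProdFun I M where
  toFun := relative f
  invFun := relative (relative f (emptyTPF I M))
  left_inv := relative_inv_relative f
  right_inv g := by
    have h := relative_inv_relative (relative f (emptyTPF I M)) g
    rwa [relative_inv_inv] at h

lemma Dtp_relative (f g h : TreeProdFun I M) :
    Dtp (relative f g) (relative f h) = Dtp g h := by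
  rw [Dtp_eq (tripod_relative (relative f g) (relative f h)), relative_relative,
    Dtp_eq (tripod_relative g h)]

end TreeProdFun

/-- the tree product is homogeneous: for every `f` there is a self-isometry
`Φ_f` of `(ΠP, D)` sending `f` to the empty function `f_∅`. -/
theorem stmt_9 (f : TreeProdFun I M) :
    ∃ Φ : TreeProdFun I M ≃ TreeProdFun I M,
      Φ f = emptyTPF I M ∧ ∀ g h : TreeProdFun I M, Dtp (Φ g) (Φ h) = Dtp g h :=
  ⟨f.relativeEquiv, f.relative_self, f.Dtp_relative⟩
end
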